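/- Let Φ be a local Zhou weight related to |f₀|²e^{-2φ₀} near o. Then for any holomorphic function G near o with G ≢ 0, ν(G, Φ) + c_o(Φ) ≤ c_o^G(Φ) ≤ ν(G, Φ) - σ(log|f₀|, Φ) + 1 + σ(φ₀, Φ). In particular, if |f₀|²e^{-2φ₀} ≡ 1 (i.e. f₀ ≡ 1 and φ₀ ≡ 0), then ν(G, Φ) + 1 = c_o^G(Φ). -/

import Mathlib

open MeasureTheory Filter Topology
open scoped ENNReal NNReal

noncomputable section

/-- `ℂⁿ`. -/
abbrev Cn (n : ℕ) : Type := Fin n → ℂ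

variable {n : ℕ}

/-- The exponential function `EReal → ℝ≥0∞`, with `exp ⊥ = 0` and `exp ⊤ = ⊤`. -/
def expE (x : EReal) : ℝ≥0∞ :=
  if x = ⊥ then 0 else if x = ⊤ then ⊤ else ENNReal.ofReal (Real.exp x.toReal)

/-- The logarithm `ℝ → EReal`, with value `⊥` for `x ≤ 0`. -/
def elog (x : ℝ) : EReal := if x ≤ 0 then (⊥ : EReal) else ((Real.log x : ℝ) : EReal)

/-- The density `e^{c·φ} : ℂⁿ → [0,∞]` associated to an extended-real-valued `φ`. -/
def wexp (c : ℝ) (φ : Cn n → EReal) (z : Cn n) : ℝ≥0∞ := expE ((c : EReal) * φ z)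

/-- `|f₀|² = ∑ⱼ |f₀ⱼ|²` as a `[0,∞]`-valued density, for a tuple `f₀` of functions. -/
def normSq2 {m : ℕ} (f₀ : Fin m → Cn n → ℂ) (z : Cn n) : ℝ≥0∞ :=
  ∑ j, (‖f₀ j z‖₊ : ℝ≥0∞) ^ 2

/-- `log |f₀| = (1/2) log ∑ⱼ |f₀ⱼ|²` for a tuple `f₀`. -/
def logAbsT {m : ℕ} (f₀ : Fin m → Cn n → ℂ) (z : Cn n) : EReal :=
  elog (Real.sqrt (∑ j, ‖f₀ j z‖ ^ 2))

/-- The weight `|f₀|² e^{-2φ₀}`. -/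
def dens0 {m : ℕ} (f₀ : Fin m → Cn n → ℂ) (φ₀ : Cn n → EReal) (z : Cn n) : ℝ≥0∞ :=
  normSq2 f₀ z * wexp (-2) φ₀ z

/-- A nonnegative function is (Lebesgue-)integrable near the origin. -/
def IntNear (g : Cn n → ℝ≥0∞) : Prop := ∃ U ∈ 𝓝 (0 : Cn n), (∫⁻ z in U, g z) < ⊤

/-- `ψ ≤ φ + O(1)` near the origin. -/
def leO (ψ φ : Cn n → EReal) : Prop := ∃ C : ℝ, ∀ᶠ z in 𝓝 (0 : Cn n), ψ z ≤ φ z + (C : EReal)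

/-- `ψ = φ + O(1)` near the origin. -/
def eqO (ψ φ : Cn n → EReal) : Prop := leO ψ φ ∧ leO φ ψ

/-- The truncated average of `u` over the circle `θ ↦ z + r e^{iθ} w`, truncated below at `-m`. -/
def circleAvg (u : Cn n → EReal) (z w : Cn n) (r : ℝ) (m : ℕ) : ℝ :=
  (2 * Real.pi)⁻¹ * ∫ θ in (0:ℝ)..(2 * Real.pi),
    (max (u (z + ((r : ℂ) * Complex.exp (Complex.I * (θ : ℂ))) • w)) ((-(m : ℝ) : ℝ) : EReal)).toReal

/-- `u` is plurisubharmonic on `Ω`: it is upper semicontinuous on `Ω`, takes values in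
`[-∞, ∞)`, is not identically `-∞` on any connected component of `Ω`, and satisfies the
sub-mean value inequality on all small circles inside complex lines. -/
structure PSHOn (u : Cn n → EReal) (Ω : Set (Cn n)) : Prop where
  usc : UpperSemicontinuousOn u Ω
  lt_top : ∀ z ∈ Ω, u z < ⊤
  not_botOnComponents : ∀ z ∈ Ω, ∃ w ∈ connectedComponentIn Ω z, u w ≠ ⊥
  submean : ∀ z ∈ Ω, ∀ w : Cn n, ∃ ε > 0, ∀ r : ℝ, 0 < r → r < ε →
    u z ≤ ⨅ m : ℕ, ((circleAvg u z w r m : ℝ) : EReal)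

/-- `u` is plurisubharmonic near the origin. -/
def PSHNear (u : Cn n → EReal) : Prop := ∃ U ∈ 𝓝 (0 : Cn n), IsOpen U ∧ PSHOn u U

/-- `f` is holomorphic near the origin. -/
def HoloNear (f : Cn n → ℂ) : Prop := ∃ U ∈ 𝓝 (0 : Cn n), IsOpen U ∧ DifferentiableOn ℂ f U

/-- `Φ` is a (local) Zhou weight near the origin related to a general nonnegative
weight `W`. -/
structure IsZhouWeightFor (W : Cn n → ℝ≥0∞) (Φ : Cn n → EReal) : Prop where
  psh : PSHNear Φ
  intN : ∃ N₁ : ℕ, ∀ N₀ : ℕ, N₁ ≤ N₀ →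
    IntNear fun z => W z * ENNReal.ofReal (‖z‖ ^ (2 * N₀)) * wexp (-2) Φ z
  nonint : ¬ IntNear fun z => W z * wexp (-2) Φ z
  maximal : ∀ φ' : Cn n → EReal, PSHNear φ' → leO Φ φ' →
    (¬ IntNear fun z => W z * wexp (-2) φ' z) → eqO φ' Φ

/-- `Φ` is a local Zhou weight related to `|f₀|² e^{-2φ₀}` near the origin (including the
standing assumptions that `f₀` is a tuple of holomorphic functions near `o`, `φ₀` is
plurisubharmonic near `o`, and `|f₀|² e^{-2φ₀}` is integrable near `o`). -/
structure IsLocalZhouWeight {m : ℕ} (f₀ : Fin m → Cn n → ℂ) (φ₀ : Cn n → EReal)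
    (Φ : Cn n → EReal) : Prop where
  holo : ∀ j, HoloNear (f₀ j)
  psh₀ : PSHNear φ₀
  int₀ : IntNear (dens0 f₀ φ₀)
  zhou : IsZhouWeightFor (dens0 f₀ φ₀) Φ

/-- The Zhou number (relative type) `σ(ψ, Φ) = sup { b ≥ 0 : ψ ≤ bΦ + O(1) near o }`. -/
def zhouNumber (ψ Φ : Cn n → EReal) : ℝ :=
  sSup {b : ℝ | 0 ≤ b ∧ leO ψ fun z => (b : EReal) * Φ z}

/-- `log ‖f‖ : ℂⁿ → EReal`. -/
def logAbs (f : Cn n → ℂ) (z : Cn n) : EReal := elog ‖f z‖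

/-- `ν(f, Φ) = σ(log|f|, Φ)`. -/
def nuNumber (f : Cn n → ℂ) (Φ : Cn n → EReal) : ℝ := zhouNumber (logAbs f) Φ

/-- The jumping number `c_o^G(Φ) = sup { c ≥ 0 : |G|² e^{-2cΦ} integrable near o }`. -/
def jumping (G : Cn n → ℂ) (Φ : Cn n → EReal) : ℝ :=
  sSup {c : ℝ | 0 ≤ c ∧ IntNear fun z => (‖G z‖₊ : ℝ≥0∞) ^ 2 * wexp (-2 * c) Φ z}

/-- The inclusion `ℐ(φ)ₒ ⊆ ℐ(ψ)ₒ` of multiplier ideals at the origin. -/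
def mIdealLE (φ ψ : Cn n → EReal) : Prop :=
  ∀ f : Cn n → ℂ, HoloNear f →
    (IntNear fun z => (‖f z‖₊ : ℝ≥0∞) ^ 2 * wexp (-2) φ z) →
    IntNear fun z => (‖f z‖₊ : ℝ≥0∞) ^ 2 * wexp (-2) ψ z

/-- The Tian function `Tn(t; f, v, φ₀) = sup { c ≥ 0 : |f|^{2t} e^{-2cv - 2φ₀} integrable near o }`. -/
def tian (t : ℝ) (f : Cn n → ℂ) (v φ₀ : Cn n → EReal) : ℝ :=
  sSup {c : ℝ | 0 ≤ c ∧
    IntNear fun z => ENNReal.ofReal (‖f z‖ ^ (2 * t)) * wexp (-2 * c) v z * wexp (-2) φ₀ z}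

/-- The affine map `x ↦ b x + d` on `EReal`. -/
def aff (b d : ℝ) (x : EReal) : EReal := (b : EReal) * x + (d : EReal)

lemma aff_coe (b d x : ℝ) : aff b d (x : EReal) = ((b * x + d : ℝ) : EReal) := by
  simp [aff]

lemma aff_bot {b : ℝ} (hb : 0 < b) (d : ℝ) : aff b d ⊥ = ⊥ := by
  simp [aff, EReal.coe_mul_bot_of_pos hb]

lemma aff_top {b : ℝ} (hb : 0 < b) (d : ℝ) : aff b d ⊤ = ⊤ := by
  simp [aff, EReal.coe_mul_top_of_pos hb]

lemma aff_mono {b : ℝ} (hb : 0 < b) (d : ℝ) : Monotone (aff b d) := by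
  intro x y hxy
  unfold aff
  gcongr

lemma aff_lt_coe_iff {b : ℝ} (hb : 0 < b) (d y : ℝ) (x : EReal) :
    aff b d x < (y : EReal) ↔ x < (((y - d) / b : ℝ) : EReal) := by
  induction x with
  | bot => simp [aff_bot hb]
  | top => simp [aff_top hb]
  | coe x =>
    rw [aff_coe, EReal.coe_lt_coe_iff, EReal.coe_lt_coe_iff, lt_div_iff₀ hb]
    constructor <;> intro h <;> linarith

/-- The local properties of plurisubharmonic functions: upper semicontinuity, values in `[-∞, ∞)`
and the sub-mean value inequality on small circles in complex lines. -/
structure SubMeanOn (u : Cn n → EReal) (U : Set (Cn n)) : Prop where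
  usc : UpperSemicontinuousOn u U
  lt_top : ∀ z ∈ U, u z < ⊤
  submean : ∀ z ∈ U, ∀ w : Cn n, ∃ ε > 0, ∀ r : ℝ, 0 < r → r < ε →
    u z ≤ ⨅ m : ℕ, ((circleAvg u z w r m : ℝ) : EReal)

lemma SubMeanOn.mono {u : Cn n → EReal} {U V : Set (Cn n)} (h : SubMeanOn u U) (hVU : V ⊆ U) :
    SubMeanOn u V where
  usc := h.usc.mono hVU
  lt_top z hz := h.lt_top z (hVU hz)
  submean z hz := h.submean z (hVU hz)

lemma PSHOn.subMeanOn {u : Cn n → EReal} {U : Set (Cn n)} (h : PSHOn u U) : SubMeanOn u U :=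
  ⟨h.usc, h.lt_top, h.submean⟩

/-- `u` satisfies the local properties of plurisubharmonic functions near the origin. -/
def SubMeanNear (u : Cn n → EReal) : Prop := ∃ U ∈ 𝓝 (0 : Cn n), IsOpen U ∧ SubMeanOn u U

lemma PSHNear.subMeanNear {u : Cn n → EReal} (h : PSHNear u) : SubMeanNear u := by
  obtain ⟨U, hU, hUo, h⟩ := h
  exact ⟨U, hU, hUo, h.subMeanOn⟩

lemma eventually_circle_mem (z w : Cn n) {V : Set (Cn n)} (hV : V ∈ 𝓝 z) :
    ∃ ε > 0, ∀ r : ℝ, 0 < r → r < ε → ∀ ζ : ℂ, ‖ζ‖ ≤ r → z + ζ • w ∈ V := by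
  have hc : Tendsto (fun ζ : ℂ => z + ζ • w) (𝓝 0) (𝓝 z) := by
    have : Continuous (fun ζ : ℂ => z + ζ • w) := by fun_prop
    simpa using this.tendsto 0
  obtain ⟨ε, hε, h⟩ := Metric.mem_nhds_iff.1 (hc hV)
  refine ⟨ε, hε, fun r _ hr ζ hζ => h ?_⟩
  simpa using hζ.trans_lt hr

lemma norm_circle {r : ℝ} (hr : 0 < r) (θ : ℝ) :
    ‖(r : ℂ) * Complex.exp (Complex.I * (θ : ℂ))‖ = r := by
  rw [norm_mul, mul_comm Complex.I, Complex.norm_exp_ofReal_mul_I]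
  simp [abs_of_pos hr]

lemma continuous_circle (z w : Cn n) (r : ℝ) :
    Continuous fun θ : ℝ => z + ((r : ℂ) * Complex.exp (Complex.I * (θ : ℂ))) • w := by
  fun_prop

lemma toReal_max_mem {x : EReal} {y s : ℝ} (hx : x ≤ (y : EReal)) :
    (max x (s : EReal)) = (((max x (s : EReal)).toReal : ℝ) : EReal) ∧
      s ≤ (max x (s : EReal)).toReal ∧ (max x (s : EReal)).toReal ≤ max y s := by
  have h1 : max x (s : EReal) ≠ ⊤ :=
    ne_of_lt (max_lt (hx.trans_lt (EReal.coe_lt_top y)) (EReal.coe_lt_top s))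
  have h2 : max x (s : EReal) ≠ ⊥ := ne_of_gt ((EReal.bot_lt_coe s).trans_le (le_max_right _ _))
  have h3 := (EReal.coe_toReal h1 h2).symm
  refine ⟨h3, ?_, ?_⟩
  · rw [← EReal.coe_le_coe_iff, ← h3]
    exact le_max_right _ _
  · rw [← EReal.coe_le_coe_iff, ← h3]
    refine max_le (hx.trans ?_) ?_
    · exact_mod_cast le_max_left y s
    · exact_mod_cast le_max_right y s

lemma intervalIntegrable_trunc {u : Cn n → EReal} {U : Set (Cn n)}
    (hu : UpperSemicontinuousOn u U) {γ : ℝ → Cn n} (hγ : Continuous γ) (hU : ∀ θ, γ θ ∈ U)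
    {y : ℝ} (hy : ∀ θ, u (γ θ) ≤ (y : EReal)) (s a b : ℝ) :
    IntervalIntegrable (fun θ => (max (u (γ θ)) (s : EReal)).toReal) volume a b := by
  have hm : Measurable fun θ => u (γ θ) := by
    apply UpperSemicontinuous.measurable
    intro θ
    have h1 : ContinuousWithinAt γ Set.univ θ := hγ.continuousAt.continuousWithinAt
    intro x hx
    have h2 := hu (γ θ) (hU θ) x hx
    have h3 : Tendsto γ (𝓝 θ) (𝓝[U] (γ θ)) :=
      tendsto_nhdsWithin_iff.2 ⟨hγ.continuousAt, Eventually.of_forall hU⟩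
    exact h3.eventually h2
  have hm' : Measurable fun θ => (max (u (γ θ)) (s : EReal)).toReal :=
    (hm.max measurable_const).ereal_toReal
  rw [intervalIntegrable_iff]
  refine Measure.integrableOn_of_bounded (M := |y| + |s|) (by simp [Set.uIoc]) 
    hm'.aestronglyMeasurable (Eventually.of_forall fun θ => ?_)
  obtain ⟨-, h1, h2⟩ := toReal_max_mem (s := s) (hy θ)
  rw [Real.norm_eq_abs, abs_le]
  constructor
  · linarith [neg_abs_le s, abs_nonneg y]
  · refine h2.trans (max_le ?_ ?_)
    · linarith [le_abs_self y, abs_nonneg s]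
    · linarith [le_abs_self s, abs_nonneg y]

/-- `max (Φ, supⱼ (bⱼ h + dⱼ))`. -/
def supAff {ι : Type*} (Φ h : Cn n → EReal) (b d : ι → ℝ) (z : Cn n) : EReal :=
  max (Φ z) (⨆ j, aff (b j) (d j) (h z))

lemma le_supAff {ι : Type*} (Φ h : Cn n → EReal) (b d : ι → ℝ) (z : Cn n) :
    Φ z ≤ supAff Φ h b d z := le_max_left _ _

lemma aff_le_supAff {ι : Type*} (Φ h : Cn n → EReal) (b d : ι → ℝ) (z : Cn n) (j : ι) :
    aff (b j) (d j) (h z) ≤ supAff Φ h b d z :=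
  (le_iSup (fun j => aff (b j) (d j) (h z)) j).trans (le_max_right _ _)

lemma circleAvg_mono_aff {u v : Cn n → EReal} {U : Set (Cn n)}
    (hu : UpperSemicontinuousOn u U) (hv : UpperSemicontinuousOn v U) {z w : Cn n} {r y : ℝ}
    (hU : ∀ θ : ℝ, z + ((r : ℂ) * Complex.exp (Complex.I * (θ : ℂ))) • w ∈ U)
    (huy : ∀ x ∈ U, u x ≤ (y : EReal)) (hvy : ∀ x ∈ U, v x ≤ (y : EReal)) {b d : ℝ} (hb : 0 < b)
    (huv : ∀ x ∈ U, aff b d (u x) ≤ v x) {m m' : ℕ} (hm : b * (-(m' : ℝ)) + d ≤ -(m : ℝ)) :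
    b * circleAvg u z w r m' + d ≤ circleAvg v z w r m := by
  have hγ := continuous_circle z w r
  have hiu := intervalIntegrable_trunc hu hγ hU (fun θ => huy _ (hU θ)) (-(m' : ℝ)) 0 (2 * Real.pi)
  have hiv := intervalIntegrable_trunc hv hγ hU (fun θ => hvy _ (hU θ)) (-(m : ℝ)) 0 (2 * Real.pi)
  have key : ∀ θ : ℝ,
      b * (max (u (z + ((r : ℂ) * Complex.exp (Complex.I * (θ : ℂ))) • w))
        ((-(m' : ℝ) : ℝ) : EReal)).toReal + d ≤
      (max (v (z + ((r : ℂ) * Complex.exp (Complex.I * (θ : ℂ))) • w))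
        ((-(m : ℝ) : ℝ) : EReal)).toReal := by
    intro θ
    set x := z + ((r : ℂ) * Complex.exp (Complex.I * (θ : ℂ))) • w with hx
    have h1 := (toReal_max_mem (s := -(m' : ℝ)) (huy x (hU θ))).1
    have h2 := (toReal_max_mem (s := -(m : ℝ)) (hvy x (hU θ))).1
    rw [← EReal.coe_le_coe_iff, ← h2, ← aff_coe, ← h1, (aff_mono hb d).map_max, aff_coe]
    exact max_le_max (huv x (hU θ)) (by exact_mod_cast hm)
  have h3 := intervalIntegral.integral_mono_on (by positivity)
    ((hiu.const_mul b).add (intervalIntegrable_const (c := d))) hiv (fun θ _ => key θ)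
  rw [intervalIntegral.integral_add (hiu.const_mul b) intervalIntegrable_const,
    intervalIntegral.integral_const_mul, intervalIntegral.integral_const] at h3
  unfold circleAvg
  have hpi : 0 < 2 * Real.pi := by positivity
  have h4 := mul_le_mul_of_nonneg_left h3 (inv_nonneg.2 hpi.le)
  refine le_trans (le_of_eq ?_) h4
  simp only [smul_eq_mul]
  field_simp
  ring

/-- A supremum of a plurisubharmonic function and of increasing affine functions of another one is
plurisubharmonic, if only finitely many of these matter away from `-∞`. -/
lemma pshNear_supAff {ι : Type*} {Φ h : Cn n → EReal} (hΦ : SubMeanNear Φ)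
    (hΦf : ∃ᶠ z in 𝓝 (0 : Cn n), Φ z ≠ ⊥) (hh : SubMeanNear h) {b d : ι → ℝ} (hb : ∀ j, 0 < b j)
    (hd : ∀ A y : ℝ, ∀ᶠ j in cofinite, b j * A + d j ≤ y) :
    PSHNear (supAff Φ h b d) := by
  obtain ⟨U₁, hU₁, hU₁o, hΦ⟩ := hΦ
  obtain ⟨U₂, hU₂, hU₂o, hh⟩ := hh
  have h0 : h 0 < ⊤ := hh.lt_top 0 (mem_of_mem_nhds hU₂)
  obtain ⟨A, hA, -⟩ := EReal.lt_iff_exists_real_btwn.1 h0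
  have hA' : ∀ᶠ z in 𝓝 (0 : Cn n), h z < A := by
    have := hh.usc 0 (mem_of_mem_nhds hU₂) A hA
    rwa [hU₂o.nhdsWithin_eq (mem_of_mem_nhds hU₂)] at this
  obtain ⟨ε, hε, hB⟩ := Metric.mem_nhds_iff.1 (inter_mem (inter_mem hU₁ hU₂) hA')
  set B := Metric.ball (0 : Cn n) ε with hBdef
  have hBo : IsOpen B := Metric.isOpen_ball
  replace hΦ := hΦ.mono (fun z hz => (hB hz).1.1 : B ⊆ U₁)
  replace hh := hh.mono (fun z hz => (hB hz).1.2 : B ⊆ U₂)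
  have hhA : ∀ z ∈ B, h z ≤ A := fun z hz => (hB hz).2.le
  -- a bound for the supremum on neighbourhoods
  have hbound : ∀ z ∈ B, ∀ y : EReal, supAff Φ h b d z < y → ∃ y' : ℝ, (y' : EReal) < y ∧
      supAff Φ h b d z < y' ∧ ∀ᶠ x in 𝓝 z, supAff Φ h b d x ≤ y' := by
    intro z hz y hy
    obtain ⟨y', hy1, hy2⟩ := EReal.lt_iff_exists_real_btwn.1 hy
    refine ⟨y', hy2, hy1, ?_⟩
    have hJ := hd A y'
    rw [Filter.eventually_cofinite] at hJ
    have e1 : ∀ᶠ x in 𝓝 z, Φ x < y' := by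
      have := hΦ.usc z hz y' ((le_supAff Φ h b d z).trans_lt hy1)
      rwa [hBo.nhdsWithin_eq hz] at this
    have e2 : ∀ᶠ x in 𝓝 z, ∀ j ∈ {j | ¬ b j * A + d j ≤ y'}, aff (b j) (d j) (h x) < y' := by
      rw [hJ.eventually_all]
      intro j _
      simp only [aff_lt_coe_iff (hb j)]
      have := hh.usc z hz _
        ((aff_lt_coe_iff (hb j) (d j) y' (h z)).1 ((aff_le_supAff Φ h b d z j).trans_lt hy1))
      rwa [hBo.nhdsWithin_eq hz] at this
    filter_upwards [e1, e2, hBo.mem_nhds hz] with x h1 h2 h3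
    refine max_le h1.le (iSup_le fun j => ?_)
    by_cases hj : b j * A + d j ≤ y'
    · calc aff (b j) (d j) (h x) ≤ aff (b j) (d j) A := aff_mono (hb j) _ (hhA x h3)
        _ ≤ y' := by rw [aff_coe]; exact_mod_cast hj
    · exact (h2 j hj).le
  have husc : UpperSemicontinuousOn (supAff Φ h b d) B := by
    intro z hz y hy
    obtain ⟨y', h1, -, h2⟩ := hbound z hz y hy
    exact mem_nhdsWithin_of_mem_nhds (h2.mono fun x hx => hx.trans_lt h1)
  have hlt : ∀ z ∈ B, supAff Φ h b d z < ⊤ := by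
    intro z hz
    refine max_lt (hΦ.lt_top z hz) ?_
    have hJ := hd A 0
    rw [Filter.eventually_cofinite] at hJ
    obtain ⟨Y, hY⟩ : ∃ Y : ℝ, ∀ j ∈ {j | ¬ b j * A + d j ≤ 0}, b j * A + d j ≤ Y := by
      obtain ⟨Y, hY⟩ := (hJ.image fun j => b j * A + d j).bddAbove
      exact ⟨Y, fun j hj => hY ⟨j, hj, rfl⟩⟩
    refine lt_of_le_of_lt (iSup_le fun j => ?_) (EReal.coe_lt_top (max Y 0))
    calc aff (b j) (d j) (h z) ≤ aff (b j) (d j) A := aff_mono (hb j) _ (hhA z hz)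
        _ = ((b j * A + d j : ℝ) : EReal) := aff_coe _ _ _
        _ ≤ ((max Y 0 : ℝ) : EReal) := by
          rw [EReal.coe_le_coe_iff]
          by_cases hj : b j * A + d j ≤ 0
          · exact hj.trans (le_max_right _ _)
          · exact (hY j hj).trans (le_max_left _ _)
  refine ⟨B, Metric.ball_mem_nhds _ hε, hBo, husc, hlt, ?_, ?_⟩
  · intro z hz
    obtain ⟨w, hw1, hw2⟩ := (hΦf.and_eventually (Metric.ball_mem_nhds _ hε)).exists
    refine ⟨w, ?_, fun hw3 => hw1 (le_bot_iff.1 (hw3 ▸ le_supAff Φ h b d w))⟩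
    rwa [IsPreconnected.connectedComponentIn (convex_ball (0 : Cn n) ε).isPreconnected hz]
  · intro z hz w
    obtain ⟨ε₁, hε₁, hs₁⟩ := hΦ.submean z hz w
    obtain ⟨ε₂, hε₂, hs₂⟩ := hh.submean z hz w
    obtain ⟨y, -, -, hy⟩ := hbound z hz ⊤ (hlt z hz)
    obtain ⟨ε₃, hε₃, hs₃⟩ := eventually_circle_mem z w (inter_mem hy (hBo.mem_nhds hz))
    refine ⟨min ε₁ (min ε₂ ε₃), lt_min hε₁ (lt_min hε₂ hε₃), fun r hr hrε => ?_⟩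
    rw [lt_min_iff, lt_min_iff] at hrε
    have hc : ∀ θ : ℝ, z + ((r : ℂ) * Complex.exp (Complex.I * (θ : ℂ))) • w ∈
        {x | supAff Φ h b d x ≤ y} ∩ B :=
      fun θ => hs₃ r hr hrε.2.2 _ (norm_circle hr θ).le
    set V := {x | supAff Φ h b d x ≤ y} ∩ B with hV
    have hVB : V ⊆ B := Set.inter_subset_right
    have hle : ∀ x ∈ V, supAff Φ h b d x ≤ ((max y A : ℝ) : EReal) := fun x hx =>
      hx.1.trans (by exact_mod_cast le_max_left y A)
    refine le_iInf fun m => max_le ?_ (iSup_le fun j => ?_)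
    · refine (hs₁ r hr hrε.1).trans ((iInf_le _ m).trans ?_)
      have := circleAvg_mono_aff (b := 1) (d := 0) (m := m) (m' := m) (hΦ.usc.mono hVB)
        (husc.mono hVB) hc (fun x hx => (le_supAff Φ h b d x).trans (hle x hx)) hle one_pos
        (fun x hx => by simpa [aff] using le_supAff Φ h b d x) (by simp)
      rw [EReal.coe_le_coe_iff]
      linarith
    · obtain ⟨m', hm'⟩ := exists_nat_ge ((m + d j) / b j)
      have hm'' : b j * (-(m' : ℝ)) + d j ≤ -(m : ℝ) := by
        rw [div_le_iff₀ (hb j)] at hm'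
        linarith
      calc aff (b j) (d j) (h z)
          ≤ aff (b j) (d j) ((circleAvg h z w r m' : ℝ) : EReal) :=
            aff_mono (hb j) _ ((hs₂ r hr hrε.2.1).trans (iInf_le _ m'))
        _ ≤ _ := by
          rw [aff_coe, EReal.coe_le_coe_iff]
          exact circleAvg_mono_aff (hh.usc.mono hVB) (husc.mono hVB) hc
            (fun x hx => (hhA x (hVB hx)).trans (by exact_mod_cast le_max_right y A)) hle (hb j)
            (fun x _ => aff_le_supAff Φ h b d x j) hm''

lemma elog_lt_coe_iff (x y : ℝ) : elog x < (y : EReal) ↔ x < Real.exp y := by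
  unfold elog
  split_ifs with h
  · simp [h.trans_lt (Real.exp_pos y)]
  · rw [EReal.coe_lt_coe_iff, Real.log_lt_iff_lt_exp (not_le.1 h)]

lemma elog_le_coe_iff (x y : ℝ) : elog x ≤ (y : EReal) ↔ x ≤ Real.exp y := by
  unfold elog
  split_ifs with h
  · simp [(h.trans_lt (Real.exp_pos y)).le]
  · rw [EReal.coe_le_coe_iff, Real.log_le_iff_le_exp (not_le.1 h)]

lemma elog_eq_bot_iff (x : ℝ) : elog x = ⊥ ↔ x ≤ 0 := by
  unfold elog
  split_ifs with h <;> simp [h]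

lemma subMeanNear_logAbs {G : Cn n → ℂ} (hG : HoloNear G) : SubMeanNear (logAbs G) := by
  obtain ⟨U, hU, hUo, hd⟩ := hG
  refine ⟨U, hU, hUo, ?_, ?_, ?_⟩
  · intro z hz y hy
    obtain ⟨y', hy1, hy2⟩ := EReal.lt_iff_exists_real_btwn.1 hy
    have h1 := (elog_lt_coe_iff _ _).1 hy1
    filter_upwards [(hd.continuousOn.norm z hz).eventually_lt_const h1] with x hx
    exact ((elog_lt_coe_iff _ _).2 hx).trans hy2
  · intro z _
    unfold logAbs elog
    split_ifs
    · exact bot_lt_top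
    · exact EReal.coe_lt_top _
  · intro z hz w
    by_cases hGz : G z = 0
    · exact ⟨1, one_pos, fun r _ _ => by simp [logAbs, hGz, elog]⟩
    have hVo : IsOpen (U ∩ G ⁻¹' {0}ᶜ) :=
      hd.continuousOn.isOpen_inter_preimage hUo isOpen_compl_singleton
    set V := U ∩ G ⁻¹' {0}ᶜ with hV
    obtain ⟨ε, hε, hs⟩ := eventually_circle_mem z w (hVo.mem_nhds ⟨hz, hGz⟩)
    refine ⟨ε, hε, fun r hr hrε => le_iInf fun m => ?_⟩
    set D := {ζ : ℂ | z + ζ • w ∈ V} with hD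
    have hDo : IsOpen D := hVo.preimage (by fun_prop)
    have hg : AnalyticOnNhd ℂ (fun ζ : ℂ => G (z + ζ • w)) (Metric.closedBall 0 |r|) := by
      have : DifferentiableOn ℂ (fun ζ : ℂ => G (z + ζ • w)) D :=
        hd.comp (by fun_prop) (fun ζ hζ => hζ.1)
      refine (this.analyticOnNhd hDo).mono fun ζ hζ => ?_
      rw [abs_of_pos hr] at hζ
      exact hs r hr hrε ζ (by simpa using hζ)
    have hne : ∀ ζ ∈ Metric.closedBall (0 : ℂ) |r|, G (z + ζ • w) ≠ 0 := by
      intro ζ hζ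
      rw [abs_of_pos hr] at hζ
      exact (hs r hr hrε ζ (by simpa using hζ)).2
    have hJ := hg.circleAverage_log_norm_of_ne_zero hne
    simp only [zero_smul, add_zero, Real.circleAverage, smul_eq_mul] at hJ
    have hcont : Continuous fun θ : ℝ => Real.log ‖G (z + circleMap 0 r θ • w)‖ := by
      have hmem : ∀ θ : ℝ, circleMap 0 r θ ∈ Metric.closedBall (0 : ℂ) |r| := fun θ => by simp
      refine Continuous.log ?_ fun θ => norm_ne_zero_iff.2 (hne _ (hmem θ))
      exact (hg.continuousOn.comp_continuous (continuous_circleMap 0 r) hmem).norm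
    have hval : ∀ x ∈ V, logAbs G x = ((Real.log ‖G x‖ : ℝ) : EReal) := by
      intro x hx
      have : ¬ ‖G x‖ ≤ 0 := by simpa using hx.2
      simp [logAbs, elog, this]
    have hcm : ∀ θ : ℝ, (r : ℂ) * Complex.exp (Complex.I * (θ : ℂ)) = circleMap 0 r θ := by
      intro θ
      simp [circleMap, mul_comm]
    have hmV : ∀ θ : ℝ, z + circleMap 0 r θ • w ∈ V := fun θ =>
      hs r hr hrε _ (by simp [abs_of_pos hr])
    rw [hval z ⟨hz, hGz⟩, EReal.coe_le_coe_iff, ← hJ]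
    unfold circleAvg
    have hmax : ∀ a b : ℝ, (max (a : EReal) (b : EReal)).toReal = max a b := fun a b => by
      rw [← EReal.coe_strictMono.monotone.map_max, EReal.toReal_coe]
    simp only [hcm, hval _ (hmV _), hmax]
    gcongr
    refine intervalIntegral.integral_mono_on (by positivity) (hcont.intervalIntegrable _ _)
      ((hcont.max continuous_const).intervalIntegrable _ _) fun θ _ => le_max_left _ _

/-- The zeros of a holomorphic function that is not locally zero form a null set. -/
lemma ae_ne_zero_near {G : Cn n → ℂ} (hG : HoloNear G)
    (hG0 : ¬ (∀ᶠ z in 𝓝 (0 : Cn n), G z = 0)) :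
    ∀ᶠ z in 𝓝 (0 : Cn n) ⊓ ae volume, G z ≠ 0 := by
  obtain ⟨U, hU, -, hd⟩ := hG
  obtain ⟨ε, hε, hB⟩ := Metric.mem_nhds_iff.1 hU
  set B := Metric.ball (0 : Cn n) ε with hBdef
  have hBo : IsOpen B := Metric.isOpen_ball
  replace hd := hd.mono hB
  obtain ⟨p, hp, hpB⟩ := ((Filter.not_eventually.1 hG0).and_eventually
    (Metric.ball_mem_nhds _ hε)).exists
  have hVo : IsOpen (B ∩ G ⁻¹' {0}ᶜ) :=
    hd.continuousOn.isOpen_inter_preimage hBo isOpen_compl_singleton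
  set Z := B \ (B ∩ G ⁻¹' {0}ᶜ) with hZ
  have hZm : MeasurableSet Z := hBo.measurableSet.diff hVo.measurableSet
  have hmem : ∀ z, z ∈ Z ↔ z ∈ B ∧ G z = 0 := by
    intro z
    simp only [hZ, Set.mem_sdiff, Set.mem_inter_iff, Set.mem_preimage, Set.mem_compl_iff,
      Set.mem_singleton_iff]
    tauto
  set S := (fun x => p + x) ⁻¹' Z with hS
  have hSm : MeasurableSet S := (measurable_const_add p) hZm
  have hT : MeasurableSet {q : ℝ × Cn n | q.1 • q.2 ∈ S} :=
    (by fun_prop : Continuous fun q : ℝ × Cn n => q.1 • q.2).measurable hSm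
  have hcount : ∀ x : Cn n, {t : ℝ | t • x ∈ S}.Countable := by
    intro x
    set D := {ζ : ℂ | p + ζ • x ∈ B} with hD
    have hDo : IsOpen D := hBo.preimage (by fun_prop)
    have hDc : Convex ℝ D := by
      have h1 : Convex ℝ B := convex_ball _ _
      intro a ha b hb s t hs ht hst
      have h2 := h1 ha hb hs ht hst
      have h3 : s • (p + a • x) + t • (p + b • x) = p + (s • a + t • b) • x := by
        have h4 : p = (s + t) • p := by rw [hst, one_smul]
        nth_rewrite 3 [h4]
        rw [smul_add, smul_add, add_smul, add_smul, smul_assoc, smul_assoc]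
        abel
      rwa [h3] at h2
    have hg : AnalyticOnNhd ℂ (fun ζ : ℂ => G (p + ζ • x)) D := by
      have : DifferentiableOn ℂ (fun ζ : ℂ => G (p + ζ • x)) D :=
        hd.comp (by fun_prop) (fun ζ hζ => hζ)
      exact this.analyticOnNhd hDo
    have h0D : (0 : ℂ) ∈ D := by
      show p + (0 : ℂ) • x ∈ B
      rw [zero_smul, add_zero]
      exact hpB
    have hcod := hg.preimage_zero_mem_codiscreteWithin (x := 0) (by simpa using hp)
      h0D ⟨⟨0, h0D⟩, hDc.isPreconnected⟩
    have hdisc := isDiscrete_of_codiscreteWithin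
      (s := (fun ζ : ℂ => G (p + ζ • x)) ⁻¹' {0}) (U := D) (by simpa using hcod)
    have hc : ((fun ζ : ℂ => G (p + ζ • x)) ⁻¹' {0} ∩ D).Countable := by
      have := hdisc.to_subtype
      exact Set.countable_coe_iff.1 (TopologicalSpace.separableSpace_iff_countable.1 inferInstance)
    refine (hc.preimage Complex.ofReal_injective).mono fun t ht => ?_
    obtain ⟨h1, h2⟩ := (hmem _).1 (show p + t • x ∈ Z from ht)
    exact ⟨by simpa using h2, by simpa [hD] using h1⟩
  have hnull : (volume : Measure ℝ).prod (volume : Measure (Cn n))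
      {q : ℝ × Cn n | q.1 • q.2 ∈ S} = 0 := by
    rw [Measure.prod_apply_symm hT, lintegral_eq_zero_iff (measurable_measure_prodMk_right hT)]
    exact Eventually.of_forall fun x => (hcount x).measure_zero volume
  rw [Measure.measure_prod_null hT] at hnull
  have hne : ∀ᵐ t : ℝ, t ≠ 0 := by simp [ae_iff]
  obtain ⟨t, ht, ht0⟩ := (hnull.and hne).exists
  have hS0 : volume S = 0 := by
    have h1 : volume ((fun x : Cn n => t • x) ⁻¹' S) = 0 := ht
    rw [Measure.addHaar_preimage_smul volume ht0] at h1
    refine (mul_eq_zero.1 h1).resolve_left ?_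
    rw [ENNReal.ofReal_eq_zero, not_le]
    positivity
  rw [hS, measure_preimage_add] at hS0
  have hae : ∀ᵐ z, z ∉ Z := measure_eq_zero_iff_ae_notMem.1 hS0
  filter_upwards [mem_inf_of_left (Metric.ball_mem_nhds (0 : Cn n) hε), mem_inf_of_right hae]
    with z hz hzZ hGz
  exact hzZ ((hmem z).2 ⟨hz, hGz⟩)

lemma wexp_bot {c : ℝ} (hc : c < 0) {φ : Cn n → EReal} {z : Cn n} (h : φ z = ⊥) :
    wexp c φ z = ⊤ := by
  simp [wexp, expE, h, EReal.coe_mul_bot_of_neg hc]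

lemma wexp_coe (c : ℝ) {φ : Cn n → EReal} {z : Cn n} {x : ℝ} (h : φ z = x) :
    wexp c φ z = ENNReal.ofReal (Real.exp (c * x)) := by
  have : wexp c φ z = expE ((c * x : ℝ) : EReal) := by simp [wexp, h]
  rw [this, expE, if_neg (EReal.coe_ne_bot _), if_neg (EReal.coe_ne_top _), EReal.toReal_coe]

lemma wexp_top {c : ℝ} (hc : c < 0) {φ : Cn n → EReal} {z : Cn n} (h : φ z = ⊤) :
    wexp c φ z = 0 := by
  simp [wexp, expE, h, EReal.coe_mul_top_of_neg hc]

lemma wexp_zero (φ : Cn n → EReal) (z : Cn n) : wexp 0 φ z = 1 := by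
  simp [wexp, expE]

lemma wexp_neg_le_of_le_add {a : ℝ} (ha : 0 < a) {φ ψ : Cn n → EReal} {z : Cn n} {C : ℝ}
    (h : φ z ≤ ψ z + C) :
    wexp (-a) ψ z ≤ ENNReal.ofReal (Real.exp (a * C)) * wexp (-a) φ z := by
  have ha' : -a < 0 := by linarith
  induction hψ : ψ z with
  | bot =>
    have : φ z = ⊥ := by
      rw [hψ, EReal.bot_add] at h
      exact le_bot_iff.1 h
    rw [wexp_bot ha' this, ENNReal.mul_top (by simp [Real.exp_pos])]
    exact le_top
  | top =>
    rw [wexp_top ha' hψ]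
    exact zero_le
  | coe x =>
    induction hφ : φ z with
    | bot =>
      rw [wexp_bot ha' hφ, ENNReal.mul_top (by simp [Real.exp_pos])]
      exact le_top
    | top =>
      rw [hψ, hφ, ← EReal.coe_add] at h
      exact absurd (top_le_iff.1 h) (EReal.coe_ne_top _)
    | coe y =>
      rw [hψ, hφ, ← EReal.coe_add, EReal.coe_le_coe_iff] at h
      rw [wexp_coe _ hψ, wexp_coe _ hφ, ← ENNReal.ofReal_mul (Real.exp_pos _).le, ← Real.exp_add]
      gcongr
      nlinarith

lemma measurable_expE : Measurable expE := by
  have : Monotone expE := by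
    have h : expE = EReal.exp := by
      funext x
      induction x <;> simp [expE]
    rw [h]
    exact EReal.exp_monotone
  exact this.measurable

lemma measurable_wexp_aux (c : ℝ) : Measurable fun x : EReal => expE ((c : EReal) * x) := by
  refine measurable_expE.comp ?_
  rcases le_total 0 c with hc | hc
  · exact Monotone.measurable fun x y hxy => mul_le_mul_of_nonneg_left hxy (by exact_mod_cast hc)
  · refine Antitone.measurable fun x y hxy => ?_
    have h1 : (((-c : ℝ) : EReal)) * x ≤ (((-c : ℝ) : EReal)) * y :=
      mul_le_mul_of_nonneg_left hxy (by exact_mod_cast (neg_nonneg.2 hc))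
    rw [EReal.coe_neg, EReal.neg_mul, EReal.neg_mul] at h1
    exact EReal.neg_le_neg_iff.1 h1

/-- `g` is almost everywhere measurable on an open neighbourhood of the origin. -/
def MeasNear (g : Cn n → ℝ≥0∞) : Prop :=
  ∃ U ∈ 𝓝 (0 : Cn n), IsOpen U ∧ AEMeasurable g (volume.restrict U)

lemma MeasNear.mul {g h : Cn n → ℝ≥0∞} (hg : MeasNear g) (hh : MeasNear h) :
    MeasNear fun z => g z * h z := by
  obtain ⟨U, hU, hUo, hg⟩ := hg
  obtain ⟨V, hV, hVo, hh⟩ := hh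
  exact ⟨U ∩ V, inter_mem hU hV, hUo.inter hVo,
    (hg.mono_set Set.inter_subset_left).mul (hh.mono_set Set.inter_subset_right)⟩

lemma MeasNear.add {g h : Cn n → ℝ≥0∞} (hg : MeasNear g) (hh : MeasNear h) :
    MeasNear fun z => g z + h z := by
  obtain ⟨U, hU, hUo, hg⟩ := hg
  obtain ⟨V, hV, hVo, hh⟩ := hh
  exact ⟨U ∩ V, inter_mem hU hV, hUo.inter hVo,
    (hg.mono_set Set.inter_subset_left).add (hh.mono_set Set.inter_subset_right)⟩

lemma MeasNear.of_measurable {g : Cn n → ℝ≥0∞} (hg : Measurable g) : MeasNear g :=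
  ⟨Set.univ, univ_mem, isOpen_univ, hg.aemeasurable⟩

lemma SubMeanNear.measNear_wexp {u : Cn n → EReal} (hu : SubMeanNear u) (c : ℝ) :
    MeasNear (wexp c u) := by
  obtain ⟨U, hU, hUo, hu⟩ := hu
  refine ⟨U, hU, hUo, (measurable_wexp_aux c).comp_aemeasurable ?_⟩
  exact aemeasurable_restrict_of_measurable_subtype hUo.measurableSet
    (upperSemicontinuousOn_iff_restrict.2 hu.usc).measurable

lemma HoloNear.measNear_sq {f : Cn n → ℂ} (hf : HoloNear f) :
    MeasNear fun z => (‖f z‖₊ : ℝ≥0∞) ^ 2 := by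
  obtain ⟨U, hU, hUo, hf⟩ := hf
  exact ⟨U, hU, hUo, ((hf.continuousOn.aemeasurable hUo.measurableSet).enorm.pow_const 2)⟩

lemma measNear_dens0 {m : ℕ} {f₀ : Fin m → Cn n → ℂ} {φ₀ : Cn n → EReal}
    (hf : ∀ j, HoloNear (f₀ j)) (hφ : SubMeanNear φ₀) : MeasNear (dens0 f₀ φ₀) := by
  refine MeasNear.mul ?_ (hφ.measNear_wexp (-2))
  have : ∀ s : Finset (Fin m), MeasNear fun z => ∑ j ∈ s, (‖f₀ j z‖₊ : ℝ≥0∞) ^ 2 := by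
    classical
    intro s
    induction s using Finset.induction_on with
    | empty => simpa using MeasNear.of_measurable measurable_const
    | insert j s hj ih =>
      simp only [Finset.sum_insert hj]
      exact (hf j).measNear_sq.add ih
  exact this Finset.univ

lemma IntNear.mono {g h : Cn n → ℝ≥0∞} (hh : IntNear h)
    (hgh : ∀ᶠ z in 𝓝 (0 : Cn n) ⊓ ae volume, g z ≤ h z) : IntNear g := by
  obtain ⟨U, hU, hU'⟩ := hh
  obtain ⟨V, hV, N, hN, hVN⟩ := Filter.mem_inf_iff_superset.1 hgh
  obtain ⟨B, hBUV, hBo, h0⟩ := mem_nhds_iff.1 (inter_mem hU hV)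
  refine ⟨B, hBo.mem_nhds h0, lt_of_le_of_lt ?_ hU'⟩
  calc ∫⁻ z in B, g z ≤ ∫⁻ z in B, h z := by
        refine setLIntegral_mono_ae' hBo.measurableSet ?_
        filter_upwards [hN] with z hz hzB
        exact hVN ⟨(hBUV hzB).2, hz⟩
    _ ≤ ∫⁻ z in U, h z := lintegral_mono_set fun z hz => (hBUV hz).1

lemma IntNear.const_mul {g : Cn n → ℝ≥0∞} (hg : IntNear g) (C : ℝ) :
    IntNear fun z => ENNReal.ofReal C * g z := by
  obtain ⟨U, hU, hU'⟩ := hg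
  refine ⟨U, hU, ?_⟩
  rw [lintegral_const_mul' _ _ ENNReal.ofReal_ne_top]
  exact ENNReal.mul_lt_top ENNReal.ofReal_lt_top hU'

lemma IntNear.add {g h : Cn n → ℝ≥0∞} (hgm : MeasNear g) (hg : IntNear g) (hh : IntNear h) :
    IntNear fun z => g z + h z := by
  obtain ⟨U, hU, hUo, hgm⟩ := hgm
  obtain ⟨V, hV, hg⟩ := hg
  obtain ⟨V', hV', hh⟩ := hh
  refine ⟨U ∩ (V ∩ V'), inter_mem hU (inter_mem hV hV'), ?_⟩
  rw [lintegral_add_left' (hgm.mono_set Set.inter_subset_left)]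
  refine ENNReal.add_lt_top.2 ⟨(lintegral_mono_set ?_).trans_lt hg,
    (lintegral_mono_set ?_).trans_lt hh⟩
  · exact fun z hz => hz.2.1
  · exact fun z hz => hz.2.2

lemma IntNear.ae_lt_top {g : Cn n → ℝ≥0∞} (hgm : MeasNear g) (hg : IntNear g) :
    ∀ᶠ z in 𝓝 (0 : Cn n) ⊓ ae volume, g z < ⊤ := by
  obtain ⟨U, hU, hUo, hgm⟩ := hgm
  obtain ⟨V, hV, hg⟩ := hg
  obtain ⟨B, hB, hBo, h0⟩ := mem_nhds_iff.1 (inter_mem hU hV)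
  have h1 := ae_lt_top' (hgm.mono_set (fun z hz => (hB hz).1))
    ((lintegral_mono_set (fun z hz => (hB hz).2)).trans_lt hg).ne
  rw [ae_restrict_iff' hBo.measurableSet] at h1
  filter_upwards [mem_inf_of_left (hBo.mem_nhds h0), mem_inf_of_right h1] with z hz hz'
  exact hz' hz

lemma SubMeanNear.eventually_le {u : Cn n → EReal} (hu : SubMeanNear u) :
    ∃ A : ℝ, 0 ≤ A ∧ ∀ᶠ z in 𝓝 (0 : Cn n), u z ≤ A := by
  obtain ⟨U, hU, hUo, hu⟩ := hu
  have h0 := mem_of_mem_nhds hU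
  obtain ⟨A, hA, -⟩ := EReal.lt_iff_exists_real_btwn.1 (hu.lt_top 0 h0)
  have := hu.usc 0 h0 A hA
  rw [hUo.nhdsWithin_eq h0] at this
  refine ⟨max A 0, le_max_right _ _, this.mono fun z hz => hz.le.trans ?_⟩
  exact_mod_cast le_max_left A 0

section Zhou

variable {W : Cn n → ℝ≥0∞} {Φ h : Cn n → EReal}

lemma IsZhouWeightFor.ae_eq_zero_of_eq_bot (hW : MeasNear W) (hZ : IsZhouWeightFor W Φ) :
    ∀ᶠ z in 𝓝 (0 : Cn n) ⊓ ae volume, Φ z = ⊥ → W z = 0 := by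
  rcases n.eq_zero_or_pos with rfl | hn
  · obtain ⟨U, hU, -, hu⟩ := hZ.psh
    obtain ⟨w, -, hw⟩ := hu.not_botOnComponents 0 (mem_of_mem_nhds hU)
    refine Eventually.of_forall fun z hz => absurd ?_ hw
    rwa [Subsingleton.elim w z]
  · have : Nonempty (Fin n) := ⟨⟨0, hn⟩⟩
    obtain ⟨N, hN⟩ := hZ.intN
    have hm : MeasNear fun z => W z * ENNReal.ofReal (‖z‖ ^ (2 * N)) * wexp (-2) Φ z :=
      (hW.mul (MeasNear.of_measurable (by fun_prop))).mul (hZ.psh.subMeanNear.measNear_wexp _)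
    have hne : ∀ᵐ z : Cn n, z ≠ 0 := by simp [ae_iff]
    filter_upwards [(hN N le_rfl).ae_lt_top hm, mem_inf_of_right hne] with z hz hz0 hbot
    rw [wexp_bot (by norm_num) hbot] at hz
    by_contra hWz
    rw [ENNReal.mul_top] at hz
    · exact lt_irrefl _ hz
    · refine mul_ne_zero hWz ?_
      rw [Ne, ENNReal.ofReal_eq_zero, not_le]
      have := norm_pos_iff.2 hz0
      positivity

lemma IsZhouWeightFor.frequently_ne_bot (hW : MeasNear W) (hZ : IsZhouWeightFor W Φ) :
    ∃ᶠ z in 𝓝 (0 : Cn n), Φ z ≠ ⊥ := by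
  intro hcon
  refine hZ.nonint (IntNear.mono (h := fun _ => 0) ⟨Set.univ, univ_mem, by simp⟩ ?_)
  filter_upwards [hZ.ae_eq_zero_of_eq_bot hW, mem_inf_of_left hcon] with z hz hz'
  simp [hz (not_not.1 hz')]

lemma IsZhouWeightFor.not_intNear_of_leO (hZ : IsZhouWeightFor W Φ) {φ : Cn n → EReal}
    (hφ : leO φ Φ) : ¬ IntNear fun z => W z * wexp (-2) φ z := by
  intro hi
  obtain ⟨C, hC⟩ := hφ
  refine hZ.nonint ((hi.const_mul (Real.exp (2 * C))).mono ?_)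
  filter_upwards [mem_inf_of_left hC] with z hz
  calc W z * wexp (-2) Φ z
      ≤ W z * (ENNReal.ofReal (Real.exp (2 * C)) * wexp (-2) φ z) := by
        gcongr
        exact wexp_neg_le_of_le_add two_pos hz
    _ = _ := by ring

lemma IsZhouWeightFor.pshNear_max (hW : MeasNear W) (hZ : IsZhouWeightFor W Φ)
    (hh : SubMeanNear h) {a : ℝ} (ha : 0 < a) :
    PSHNear fun z => max (Φ z) (aff a 0 (h z)) := by
  have heq : supAff Φ h (fun _ : Unit => a) (fun _ => 0) = fun z => max (Φ z) (aff a 0 (h z)) := by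
    funext z
    simp [supAff]
  rw [← heq]
  exact pshNear_supAff hZ.psh.subMeanNear (hZ.frequently_ne_bot hW) hh (fun _ => ha)
    (fun A y => by simp [Filter.cofinite_eq_bot])

lemma IsZhouWeightFor.intNear_or_leO (hW : MeasNear W) (hZ : IsZhouWeightFor W Φ)
    (hh : SubMeanNear h) {a : ℝ} (ha : 0 < a) :
    (IntNear fun z => W z * wexp (-2) (fun z => max (Φ z) (aff a 0 (h z))) z) ∨
      leO (fun z => aff a 0 (h z)) Φ := by
  by_cases hi : IntNear fun z => W z * wexp (-2) (fun z => max (Φ z) (aff a 0 (h z))) z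
  · exact Or.inl hi
  right
  obtain ⟨C, hC⟩ := (hZ.maximal _ (hZ.pshNear_max hW hh ha)
    ⟨0, Eventually.of_forall fun z => by simp⟩ hi).1
  exact ⟨C, hC.mono fun z hz => (le_max_right _ _).trans hz⟩

end Zhou

lemma wexp_neg_anti {a : ℝ} (ha : 0 < a) {φ ψ : Cn n → EReal} {z : Cn n} (h : φ z ≤ ψ z) :
    wexp (-a) ψ z ≤ wexp (-a) φ z := by
  simpa using wexp_neg_le_of_le_add (C := 0) ha (φ := φ) (ψ := ψ) (z := z) (by simpa using h)

lemma measurableSet_superlevel {h : Cn n → EReal} {B : Set (Cn n)} (hB : IsOpen B)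
    (hh : UpperSemicontinuousOn h B) (y : EReal) : MeasurableSet {z ∈ B | y ≤ h z} := by
  obtain ⟨V, hV, hBV⟩ := upperSemicontinuousOn_iff_preimage_Iio.1 hh y
  have : {z ∈ B | y ≤ h z} = B \ (B ∩ V) := by
    rw [← hBV]
    ext z
    simp only [Set.mem_ofPred_eq, Set.mem_sdiff, Set.mem_inter_iff, Set.mem_preimage, Set.mem_Iio]
    constructor
    · rintro ⟨h1, h2⟩
      exact ⟨h1, fun h3 => not_lt.2 h2 h3.2⟩
    · rintro ⟨h1, h2⟩
      exact ⟨h1, not_lt.1 fun h3 => h2 ⟨h1, h3⟩⟩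
  rw [this]
  exact hB.measurableSet.diff (hB.inter hV).measurableSet

lemma exists_superlevel_lintegral_ge {g : Cn n → ℝ≥0∞} {h : Cn n → EReal} {r : ℝ} (hr : 0 < r)
    (hg : ¬ IntNear g) (hh : UpperSemicontinuousOn h (Metric.ball 0 r))
    (hbot : ∀ᵐ z, z ∈ Metric.ball (0 : Cn n) r → h z = ⊥ → g z = 0) (K : ℕ) :
    ∃ M : ℕ, (K : ℝ≥0∞) ≤
      ∫⁻ z in {z ∈ Metric.ball (0 : Cn n) r | ((-(M : ℝ) : ℝ) : EReal) ≤ h z}, g z := by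
  by_contra! hcon
  set E : ℕ → Set (Cn n) :=
    fun M => {z ∈ Metric.ball (0 : Cn n) r | ((-(M : ℝ) : ℝ) : EReal) ≤ h z} with hE
  have hEm : ∀ M, MeasurableSet (E M) := fun M => measurableSet_superlevel Metric.isOpen_ball hh _
  have hmono : Monotone E := by
    intro M M' hM z hz
    refine ⟨hz.1, le_trans ?_ hz.2⟩
    have : (M : ℝ) ≤ M' := by exact_mod_cast hM
    exact EReal.coe_le_coe_iff.2 (by linarith)
  have hun : ∀ z ∈ Metric.ball (0 : Cn n) r \ ⋃ M, E M, h z = ⊥ := by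
    rintro z ⟨hzB, hz⟩
    by_contra hne
    obtain ⟨x, -, hx⟩ := EReal.lt_iff_exists_real_btwn.1 (bot_lt_iff_ne_bot.2 hne)
    obtain ⟨M, hM⟩ := exists_nat_ge (-x)
    refine hz (Set.mem_iUnion.2 ⟨M, hzB, le_trans ?_ hx.le⟩)
    exact EReal.coe_le_coe_iff.2 (by linarith)
  refine hg ⟨Metric.ball 0 r, Metric.ball_mem_nhds _ hr, ?_⟩
  calc ∫⁻ z in Metric.ball 0 r, g z
      ≤ ∫⁻ z in (⋃ M, E M) ∪ (Metric.ball 0 r \ ⋃ M, E M), g z :=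
        lintegral_mono_set (by rw [Set.union_sdiff_self]; exact Set.subset_union_right)
    _ ≤ (∫⁻ z in ⋃ M, E M, g z) + ∫⁻ z in Metric.ball 0 r \ ⋃ M, E M, g z :=
        lintegral_union_le _ _ _
    _ ≤ K + 0 := by
        gcongr
        · rw [setLIntegral_iUnion_of_directed _ hmono.directed_le]
          exact iSup_le fun M => (hcon M).le
        · calc ∫⁻ z in Metric.ball 0 r \ ⋃ M, E M, g z
              ≤ ∫⁻ z in Metric.ball (0 : Cn n) r \ ⋃ M, E M, 0 := by
                refine setLIntegral_mono_ae'
                  (measurableSet_ball.diff (MeasurableSet.iUnion hEm)) ?_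
                filter_upwards [hbot] with z hz hzE
                rw [hz hzE.1 (hun z hzE)]
            _ = 0 := by simp
    _ < ⊤ := by simp

section Zhou

variable {W : Cn n → ℝ≥0∞} {Φ h : Cn n → EReal}

lemma IsZhouWeightFor.exists_lt_neg (hi : IntNear W) (hZ : IsZhouWeightFor W Φ)
    (hbot : ∀ᶠ z in 𝓝 (0 : Cn n) ⊓ ae volume, h z = ⊥ → W z = 0) {r : ℝ} (hr : 0 < r) (K : ℝ) :
    ∃ z ∈ Metric.ball (0 : Cn n) r, h z ≠ ⊥ ∧ Φ z < ((-K : ℝ) : EReal) := by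
  by_contra! hcon
  refine hZ.nonint ((hi.const_mul (Real.exp (2 * K))).mono ?_)
  filter_upwards [hbot, mem_inf_of_left (Metric.ball_mem_nhds (0 : Cn n) hr)] with z hz hzB
  by_cases hb : h z = ⊥
  · simp [hz hb]
  have h1 : (fun _ : Cn n => (0 : EReal)) z ≤ Φ z + (K : EReal) := by
    calc (0 : EReal) = ((-K : ℝ) : EReal) + (K : EReal) := by
          rw [← EReal.coe_add]; simp
      _ ≤ Φ z + K := by
        gcongr
        exact hcon z hzB hb
  have h2 := wexp_neg_le_of_le_add (φ := fun _ : Cn n => (0 : EReal)) two_pos h1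
  have h3 : wexp (-2) (fun _ : Cn n => (0 : EReal)) z = 1 := by
    rw [wexp_coe (x := 0) _ (by simp)]
    simp
  rw [h3, mul_one] at h2
  rw [mul_comm]
  gcongr

lemma leO_aff_of_not_bddAbove (hΦ : SubMeanNear Φ)
    (hS : ¬ BddAbove {b : ℝ | 0 ≤ b ∧ leO h fun z => (b : EReal) * Φ z})
    {β : ℝ} (hβ : 0 < β) (d : ℝ) : leO (fun z => aff β d (h z)) Φ := by
  obtain ⟨A, hA0, hA⟩ := hΦ.eventually_le
  obtain ⟨b, ⟨-, C, hC⟩, hb⟩ := not_bddAbove_iff.1 hS (1 / β)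
  have hb0 : 0 < b := lt_trans (by positivity) hb
  have hb1 : 1 < β * b := by
    rwa [div_lt_iff₀ hβ, mul_comm] at hb
  refine ⟨(β * b - 1) * A + β * C + d, ?_⟩
  filter_upwards [hA, hC] with z hzA hzC
  induction hΦz : Φ z with
  | bot =>
    rw [hΦz, EReal.coe_mul_bot_of_pos hb0, EReal.bot_add, le_bot_iff] at hzC
    rw [hzC, aff_bot hβ]
    exact bot_le
  | top => exact absurd (top_le_iff.1 (hΦz ▸ hzA)) (EReal.coe_ne_top _)
  | coe x =>
    rw [hΦz] at hzA hzC
    have hxA : x ≤ A := EReal.coe_le_coe_iff.1 hzA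
    refine (aff_mono hβ d hzC).trans ?_
    rw [← EReal.coe_mul, ← EReal.coe_add, aff_coe, ← EReal.coe_add, EReal.coe_le_coe_iff]
    nlinarith

/-- Data of one stage in the construction of a larger non-integrable weight. -/
structure Stage (Φ h : Cn n → EReal) (A : ℝ) where
  φ : Cn n → EReal
  b : ℝ
  c : ℝ
  b_pos : 0 < b
  b_le : b ≤ 1
  c_nonneg : 0 ≤ c
  le_φ : ∀ z, Φ z ≤ φ z
  leO_φ : leO φ Φ
  aff_le : ∀ z, aff b (-c - A) (h z) ≤ φ z

lemma Stage.exists_next (hi : IntNear W) (hZ : IsZhouWeightFor W Φ) {ρ A : ℝ} (hρ : 0 < ρ)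
    (hA : 0 ≤ A)
    (hh : UpperSemicontinuousOn h (Metric.ball 0 ρ))
    (hbot : ∀ᵐ z, z ∈ Metric.ball (0 : Cn n) ρ → h z = ⊥ → W z = 0)
    (hlt : ∀ z ∈ Metric.ball (0 : Cn n) ρ, h z < ⊤)
    (hall : ∀ β : ℝ, 0 < β → ∀ d : ℝ, leO (fun z => aff β d (h z)) Φ) (j : ℕ) (s : Stage Φ h A) :
    ∃ s' : Stage Φ h A, (∀ z, s.φ z ≤ s'.φ z) ∧ s.c + 1 ≤ s'.c ∧
      (∃ M : ℕ, M + s.c + A ≤ s'.c ∧ (j : ℝ≥0∞) ≤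
        ∫⁻ z in {z ∈ Metric.ball (0 : Cn n) (ρ / (j + 1)) | ((-(M : ℝ) : ℝ) : EReal) ≤ h z},
          W z * wexp (-2) s.φ z) ∧
      ∃ z ∈ Metric.ball (0 : Cn n) (ρ / (j + 1)),
        ¬ aff s'.b (-s'.c - A) (h z) ≤ Φ z + ((j : ℝ) : EReal) := by
  have hr : 0 < ρ / ((j : ℝ) + 1) := by positivity
  have hsub : Metric.ball (0 : Cn n) (ρ / (j + 1)) ⊆ Metric.ball 0 ρ :=
    Metric.ball_subset_ball (div_le_self hρ.le (by linarith [j.cast_nonneg (α := ℝ)]))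
  obtain ⟨M, hM⟩ := exists_superlevel_lintegral_ge hr (hZ.not_intNear_of_leO s.leO_φ)
    (hh.mono hsub) (by
      filter_upwards [hbot] with z hz hzB hzb
      rw [hz (hsub hzB) hzb, zero_mul]) j
  have hs0 := s.c_nonneg
  have hbot' : ∀ᶠ z in 𝓝 (0 : Cn n) ⊓ ae volume, h z = ⊥ → W z = 0 := by
    filter_upwards [mem_inf_of_left (Metric.ball_mem_nhds (0 : Cn n) hρ), mem_inf_of_right hbot]
      with z hz hz' using hz' hz
  set c' : ℝ := M + s.c + A + 1 with hc'
  obtain ⟨z, hzB, hzb, hzΦ⟩ := hZ.exists_lt_neg hi hbot' hr (c' + A + j + 2)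
  set x := (h z).toReal
  have hx : h z = (x : EReal) := (EReal.coe_toReal (hlt z (hsub hzB)).ne hzb).symm
  set b' : ℝ := 1 / (1 + |x|) with hb'
  have hb'_pos : 0 < b' := by positivity
  have hb'_le : b' ≤ 1 := by
    rw [hb', div_le_one (by positivity)]
    linarith [abs_nonneg x]
  have hb'_mul : -1 ≤ b' * x := by
    rw [hb', div_mul_eq_mul_div, one_mul, le_div_iff₀ (by positivity)]
    linarith [neg_abs_le x]
  refine ⟨⟨fun z => max (s.φ z) (aff b' (-c' - A) (h z)), b', c', hb'_pos, hb'_le,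
    by positivity, fun z => (s.le_φ z).trans (le_max_left _ _), ?_, fun z => le_max_right _ _⟩,
    fun z => le_max_left _ _, ?_, ⟨M, ?_, hM⟩, z, hzB, ?_⟩
  · obtain ⟨C₁, h₁⟩ := s.leO_φ
    obtain ⟨C₂, h₂⟩ := hall b' hb'_pos (-c' - A)
    refine ⟨max C₁ C₂, ?_⟩
    filter_upwards [h₁, h₂] with z hz₁ hz₂
    refine max_le (hz₁.trans ?_) (hz₂.trans ?_)
    · gcongr
      exact le_max_left _ _
    · gcongr
      exact le_max_right _ _
  · have := M.cast_nonneg (α := ℝ)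
    show s.c + 1 ≤ c'
    linarith
  · show M + s.c + A ≤ c'
    linarith
  · show ¬ aff b' (-c' - A) (h z) ≤ _
    rw [hx, aff_coe, not_le]
    calc Φ z + ((j : ℝ) : EReal) ≤ ((-(c' + A + j + 2) : ℝ) : EReal) + ((j : ℝ) : EReal) := by
          gcongr
      _ < ((b' * x + (-c' - A) : ℝ) : EReal) := by
          rw [← EReal.coe_add, EReal.coe_lt_coe_iff]
          linarith

lemma IsZhouWeightFor.bddAbove (hW : MeasNear W) (hi : IntNear W) (hZ : IsZhouWeightFor W Φ)
    (hh : SubMeanNear h) (hbot : ∀ᶠ z in 𝓝 (0 : Cn n) ⊓ ae volume, h z = ⊥ → W z = 0) :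
    BddAbove {b : ℝ | 0 ≤ b ∧ leO h fun z => (b : EReal) * Φ z} := by
  by_contra hS
  have hall : ∀ β : ℝ, 0 < β → ∀ d : ℝ, leO (fun z => aff β d (h z)) Φ :=
    fun β hβ d => leO_aff_of_not_bddAbove hZ.psh.subMeanNear hS hβ d
  obtain ⟨A, hA0, hA⟩ := hh.eventually_le
  obtain ⟨U, hU, hUo, hhU⟩ := id hh
  obtain ⟨V, hV, N, hN, hVN⟩ := Filter.mem_inf_iff_superset.1 hbot
  obtain ⟨ρ, hρ, hρU⟩ := Metric.mem_nhds_iff.1 (inter_mem hU (inter_mem hV hA))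
  have hhρ : UpperSemicontinuousOn h (Metric.ball 0 ρ) := hhU.usc.mono fun z hz => (hρU hz).1
  have hAρ : ∀ z ∈ Metric.ball (0 : Cn n) ρ, h z ≤ A := fun z hz => (hρU hz).2.2
  have hbotρ : ∀ᵐ z, z ∈ Metric.ball (0 : Cn n) ρ → h z = ⊥ → W z = 0 := by
    filter_upwards [hN] with z hz hzB
    exact hVN ⟨(hρU hzB).2.1, hz⟩
  choose next hnext_φ hnext_c hnext_int hnext_far using
    Stage.exists_next (A := A) hi hZ hρ hA0 hhρ hbotρ
      (fun z hz => hhU.lt_top z (hρU hz).1) hall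
  choose M hMc hMint using hnext_int
  have hstart : leO (fun z => max (Φ z) (aff 1 (-0 - A) (h z))) Φ := by
    obtain ⟨C, hC⟩ := hall 1 one_pos (-0 - A)
    refine ⟨max C 0, hC.mono fun z hz => max_le ?_ (hz.trans ?_)⟩
    · calc Φ z = Φ z + ((0 : ℝ) : EReal) := by simp
        _ ≤ _ := by
          gcongr
          exact le_max_right _ _
    · gcongr
      exact le_max_left _ _
  let s : ℕ → Stage Φ h A := fun j => Nat.rec
    ⟨fun z => max (Φ z) (aff 1 (-0 - A) (h z)), 1, 0, one_pos, le_rfl, le_rfl,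
      fun z => le_max_left _ _, hstart, fun z => le_max_right _ _⟩ next j
  have hs : ∀ j, s (j + 1) = next j (s j) := fun j => rfl
  have hφmono : ∀ z, Monotone fun j => (s j).φ z := fun z =>
    monotone_nat_of_le_succ fun j => by
      rw [hs]
      exact hnext_φ j (s j) z
  have hcmono : Monotone fun j => (s j).c :=
    monotone_nat_of_le_succ fun j => by
      rw [hs]
      linarith [hnext_c j (s j)]
  have hcge : ∀ j : ℕ, (j : ℝ) ≤ (s j).c := by
    intro j
    induction j with
    | zero => exact_mod_cast (s 0).c_nonneg
    | succ j ih =>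
      have := hnext_c j (s j)
      rw [← hs] at this
      push_cast
      linarith
  set φ' : Cn n → EReal := supAff Φ h (fun j => (s j).b) (fun j => -(s j).c - A) with hφ'
  have hpsh : PSHNear φ' := by
    refine pshNear_supAff hZ.psh.subMeanNear (hZ.frequently_ne_bot hW) hh
      (fun j => (s j).b_pos) fun A' y => ?_
    rw [Nat.cofinite_eq_atTop]
    obtain ⟨N, hN⟩ := exists_nat_ge (|A'| - y)
    filter_upwards [eventually_ge_atTop N] with j hj
    have h1 : (N : ℝ) ≤ j := by exact_mod_cast hj
    have h2 : (s j).b * A' ≤ |A'| := by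
      calc (s j).b * A' ≤ (s j).b * |A'| :=
            mul_le_mul_of_nonneg_left (le_abs_self _) (s j).b_pos.le
        _ ≤ 1 * |A'| := mul_le_mul_of_nonneg_right (s j).b_le (abs_nonneg _)
        _ = |A'| := one_mul _
    linarith [hcge j]
  have hball : ∀ V ∈ 𝓝 (0 : Cn n), ∃ J : ℕ, ∀ j : ℕ, J ≤ j →
      Metric.ball (0 : Cn n) (ρ / (j + 1)) ⊆ V := by
    intro V hV
    obtain ⟨ε, hε, hεV⟩ := Metric.mem_nhds_iff.1 hV
    obtain ⟨J, hJ⟩ := exists_nat_ge (ρ / ε)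
    refine ⟨J, fun j hj => (Metric.ball_subset_ball ?_).trans hεV⟩
    have h1 : (J : ℝ) ≤ j := by exact_mod_cast hj
    rw [div_le_iff₀ hε] at hJ
    rw [div_le_iff₀ (by positivity)]
    nlinarith
  have hφ'le : ∀ j z, z ∈ Metric.ball (0 : Cn n) ρ →
      ((-(M j (s j) : ℝ) : ℝ) : EReal) ≤ h z → φ' z ≤ (s j).φ z := by
    intro j z hzB hzM
    refine max_le ((s j).le_φ z) (iSup_le fun k => ?_)
    rcases le_or_gt k j with hk | hk
    · exact ((s k).aff_le z).trans (hφmono z hk)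
    · have h1 : (s (j + 1)).c ≤ (s k).c := hcmono hk
      rw [hs] at h1
      have h2 := hMc j (s j)
      calc aff (s k).b (-(s k).c - A) (h z) ≤ aff (s k).b (-(s k).c - A) A :=
            aff_mono (s k).b_pos _ (hAρ z hzB)
        _ ≤ aff (s j).b (-(s j).c - A) ((-(M j (s j) : ℝ) : ℝ) : EReal) := by
            rw [aff_coe, aff_coe, EReal.coe_le_coe_iff]
            have h3 := mul_le_mul_of_nonneg_right (s k).b_le hA0
            have h4 := mul_le_mul_of_nonneg_right (s j).b_le (M j (s j)).cast_nonneg (α := ℝ)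
            linarith
        _ ≤ aff (s j).b (-(s j).c - A) (h z) := aff_mono (s j).b_pos _ hzM
        _ ≤ (s j).φ z := (s j).aff_le z
  have hnon : ¬ IntNear fun z => W z * wexp (-2) φ' z := by
    rintro ⟨V, hV, hVint⟩
    obtain ⟨J, hJ⟩ := hball V hV
    obtain ⟨K, hK⟩ := ENNReal.exists_nat_gt hVint.ne
    set j := max J K with hj
    have hsub : Metric.ball (0 : Cn n) (ρ / (j + 1)) ⊆ Metric.ball 0 ρ :=
      Metric.ball_subset_ball (div_le_self hρ.le (by linarith [j.cast_nonneg (α := ℝ)]))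
    have hKj : (K : ℝ≥0∞) ≤ j := by exact_mod_cast le_max_right J K
    refine absurd hK (not_lt.2 (hKj.trans ((hMint j (s j)).trans ?_)))
    refine le_trans (setLIntegral_mono' (measurableSet_superlevel Metric.isOpen_ball
      (hhρ.mono hsub) _) (g := fun z => W z * wexp (-2) φ' z) fun z hz => ?_)
      (lintegral_mono_set fun z hz => hJ j (le_max_left _ _) hz.1)
    gcongr
    exact wexp_neg_anti two_pos (hφ'le j z (hsub hz.1) hz.2)
  obtain ⟨C, hC⟩ := (hZ.maximal φ' hpsh
    ⟨0, Eventually.of_forall fun z => by simpa using le_supAff _ _ _ _ z⟩ hnon).1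
  obtain ⟨J, hJ⟩ := hball _ hC
  obtain ⟨K, hK⟩ := exists_nat_ge C
  set j := max J K with hj
  obtain ⟨z, hzB, hz⟩ := hnext_far j (s j)
  refine hz ?_
  rw [← hs]
  calc aff (s (j + 1)).b (-(s (j + 1)).c - A) (h z) ≤ φ' z :=
        aff_le_supAff Φ h (fun j => (s j).b) (fun j => -(s j).c - A) z (j + 1)
    _ ≤ Φ z + C := hJ j (le_max_left _ _) hzB
    _ ≤ Φ z + ((j : ℝ) : EReal) := by
        gcongr
        exact hK.trans (by exact_mod_cast le_max_right J K)

end Zhou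

lemma aff_inv_le {a : ℝ} (ha : 0 < a) {x y : EReal} (h : x ≤ (a : EReal) * y) :
    aff (1 / a) 0 x ≤ y := by
  have ha' : 0 < 1 / a := by positivity
  refine (aff_mono ha' 0 h).trans ?_
  induction y with
  | bot => rw [EReal.coe_mul_bot_of_pos ha, aff_bot ha']
  | top => exact le_top
  | coe y =>
    rw [← EReal.coe_mul, aff_coe, EReal.coe_le_coe_iff]
    exact le_of_eq (by field_simp; ring)

lemma le_mul_of_aff_inv_le {a : ℝ} (ha : 0 < a) {x y : EReal} {C : ℝ}
    (h : aff (1 / a) 0 x ≤ y + C) : x ≤ (a : EReal) * y + ((a * C : ℝ) : EReal) := by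
  have ha' : 0 < 1 / a := by positivity
  have h1 := aff_mono ha 0 h
  have h2 : aff a 0 (aff (1 / a) 0 x) = x := by
    induction x with
    | bot => rw [aff_bot ha', aff_bot ha]
    | top => rw [aff_top ha', aff_top ha]
    | coe x =>
      rw [aff_coe, aff_coe]
      congr 1
      field_simp
      ring
  rw [h2] at h1
  refine h1.trans ?_
  induction y with
  | bot => rw [EReal.bot_add, aff_bot ha]; exact bot_le
  | top =>
    rw [EReal.coe_mul_top_of_pos ha, EReal.top_add_coe]
    exact le_top
  | coe y =>
    rw [← EReal.coe_add, aff_coe, ← EReal.coe_mul, ← EReal.coe_add, EReal.coe_le_coe_iff]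
    exact le_of_eq (by ring)

lemma coe_nnnorm_sq (w : ℂ) : (‖w‖₊ : ℝ≥0∞) ^ 2 = ENNReal.ofReal (‖w‖ ^ 2) := by
  rw [ENNReal.ofReal_pow (norm_nonneg _), ofReal_norm, enorm_eq_nnnorm]

lemma normSq2_eq_ofReal {m : ℕ} (f₀ : Fin m → Cn n → ℂ) (z : Cn n) :
    normSq2 f₀ z = ENNReal.ofReal (∑ j, ‖f₀ j z‖ ^ 2) := by
  rw [ENNReal.ofReal_sum_of_nonneg fun _ _ => by positivity]
  exact Finset.sum_congr rfl fun j _ => coe_nnnorm_sq _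

lemma exp_le_nnnorm_sq {G : Cn n → ℂ} {z : Cn n} {x : ℝ} (h : (x : EReal) < logAbs G z) :
    ENNReal.ofReal (Real.exp (2 * x)) ≤ (‖G z‖₊ : ℝ≥0∞) ^ 2 := by
  have h1 : Real.exp x < ‖G z‖ := by
    rw [← not_le, ← elog_le_coe_iff, not_le]
    exact h
  rw [coe_nnnorm_sq, two_mul, Real.exp_add, ← sq]
  gcongr

lemma nnnorm_sq_le_exp {G : Cn n → ℂ} {z : Cn n} {x : ℝ} (h : logAbs G z ≤ x) :
    (‖G z‖₊ : ℝ≥0∞) ^ 2 ≤ ENNReal.ofReal (Real.exp (2 * x)) := by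
  have h1 : ‖G z‖ ≤ Real.exp x := (elog_le_coe_iff _ _).1 h
  rw [coe_nnnorm_sq, two_mul, Real.exp_add, ← sq]
  gcongr

lemma normSq2_le_exp {m : ℕ} {f₀ : Fin m → Cn n → ℂ} {z : Cn n} {x : ℝ} (h : logAbsT f₀ z ≤ x) :
    normSq2 f₀ z ≤ ENNReal.ofReal (Real.exp (2 * x)) := by
  have h1 := (elog_le_coe_iff _ _).1 h
  rw [Real.sqrt_le_left (Real.exp_pos x).le] at h1
  rw [normSq2_eq_ofReal, two_mul, Real.exp_add, ← sq]
  gcongr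

lemma normSq2_eq_zero {m : ℕ} {f₀ : Fin m → Cn n → ℂ} {z : Cn n} (h : logAbsT f₀ z = ⊥) :
    normSq2 f₀ z = 0 := by
  have h1 := (elog_eq_bot_iff _).1 h
  rw [normSq2_eq_ofReal, ENNReal.ofReal_eq_zero]
  exact Real.sqrt_eq_zero'.1 (le_antisymm h1 (Real.sqrt_nonneg _))

lemma logAbs_eq_bot_iff {G : Cn n → ℂ} {z : Cn n} : logAbs G z = ⊥ ↔ G z = 0 := by
  rw [logAbs, elog_eq_bot_iff, norm_le_zero_iff]

lemma leO_zero_mul {h Φ : Cn n → EReal} {A : ℝ} (hA : ∀ᶠ z in 𝓝 (0 : Cn n), h z ≤ A) :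
    leO h fun z => ((0 : ℝ) : EReal) * Φ z :=
  ⟨A, hA.mono fun z hz => by simpa using hz⟩

lemma eventually_logAbsT_le {m : ℕ} {f₀ : Fin m → Cn n → ℂ} (hf : ∀ j, HoloNear (f₀ j)) :
    ∃ A : ℝ, ∀ᶠ z in 𝓝 (0 : Cn n), logAbsT f₀ z ≤ A := by
  have hc : ContinuousAt (fun z => Real.sqrt (∑ j, ‖f₀ j z‖ ^ 2)) (0 : Cn n) := by
    refine ContinuousAt.sqrt (tendsto_finsetSum _ fun j _ => ?_)
    obtain ⟨U, hU, -, hd⟩ := hf j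
    exact ((hd.continuousOn.continuousAt hU).norm).pow 2
  set R := Real.sqrt (∑ j, ‖f₀ j 0‖ ^ 2)
  have hR : 0 ≤ R := Real.sqrt_nonneg _
  refine ⟨Real.log (R + 1), ?_⟩
  filter_upwards [hc.eventually (gt_mem_nhds (show R < R + 1 by linarith))] with z hz
  rw [logAbsT, elog_le_coe_iff, Real.exp_log (by linarith)]
  exact hz.le

lemma intNear_one : IntNear fun _ : Cn n => (1 : ℝ≥0∞) :=
  ⟨Metric.ball 0 1, Metric.ball_mem_nhds _ one_pos, by
    rw [setLIntegral_one]
    exact measure_ball_lt_top⟩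

section Zhou

variable {W : Cn n → ℝ≥0∞} {Φ h : Cn n → EReal}

lemma IsZhouWeightFor.intNear_max (hW : MeasNear W) (hZ : IsZhouWeightFor W Φ)
    (hh : SubMeanNear h) (hS : BddAbove {b : ℝ | 0 ≤ b ∧ leO h fun z => (b : EReal) * Φ z})
    {a : ℝ} (ha0 : 0 < a) (ha : zhouNumber h Φ < a) :
    IntNear fun z => W z * wexp (-2) (fun z => max (Φ z) (aff (1 / a) 0 (h z))) z := by
  refine (hZ.intNear_or_leO hW hh (one_div_pos.2 ha0)).resolve_right fun ⟨C, hC⟩ => ?_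
  refine absurd (le_csSup hS ⟨ha0.le, a * C, hC.mono fun z hz => ?_⟩) (not_le.2 ha)
  exact le_mul_of_aff_inv_le ha0 hz

lemma wexp_le_wexp_max {a : ℝ} (ha : 0 < a) {z : Cn n} (hz : h z ≤ (a : EReal) * Φ z) :
    wexp (-2) Φ z ≤ wexp (-2) (fun z => max (Φ z) (aff (1 / a) 0 (h z))) z :=
  wexp_neg_anti two_pos (φ := fun z => max (Φ z) (aff (1 / a) 0 (h z)))
    (max_le le_rfl (aff_inv_le ha hz))

end Zhou

section Local

variable {m : ℕ} {f₀ : Fin m → Cn n → ℂ} {φ₀ Φ : Cn n → EReal} {G : Cn n → ℂ}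

lemma IsLocalZhouWeight.measNear (hΦ : IsLocalZhouWeight f₀ φ₀ Φ) : MeasNear (dens0 f₀ φ₀) :=
  measNear_dens0 hΦ.holo hΦ.psh₀.subMeanNear

lemma IsLocalZhouWeight.bddAbove_nu (hΦ : IsLocalZhouWeight f₀ φ₀ Φ) (hG : HoloNear G)
    (hG0 : ¬ (∀ᶠ z in 𝓝 (0 : Cn n), G z = 0)) :
    BddAbove {b : ℝ | 0 ≤ b ∧ leO (logAbs G) fun z => (b : EReal) * Φ z} :=
  hΦ.zhou.bddAbove hΦ.measNear hΦ.int₀ (subMeanNear_logAbs hG)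
    ((ae_ne_zero_near hG hG0).mono fun _ hz hz' => absurd (logAbs_eq_bot_iff.1 hz') hz)

lemma IsLocalZhouWeight.bddAbove_sigma (hΦ : IsLocalZhouWeight f₀ φ₀ Φ) :
    BddAbove {b : ℝ | 0 ≤ b ∧ leO φ₀ fun z => (b : EReal) * Φ z} := by
  refine hΦ.zhou.bddAbove hΦ.measNear hΦ.int₀ hΦ.psh₀.subMeanNear ?_
  filter_upwards [hΦ.int₀.ae_lt_top hΦ.measNear] with z hz hbot
  rw [dens0, wexp_bot (by norm_num) hbot] at hz
  rw [dens0]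
  by_contra hne
  rw [ENNReal.mul_top (left_ne_zero_of_mul hne)] at hz
  exact lt_irrefl _ hz

lemma dens0_mul_wexp_le {a b c s A C : ℝ} (hb : 0 ≤ b) (ha : 0 < a) (hs : 0 < s)
    (hc : a + s + 1 - b < c) {z : Cn n} (hzA : Φ z ≤ A) (hφ : φ₀ z < ⊤)
    (hf : logAbsT f₀ z ≤ (b : EReal) * Φ z + (C : EReal))
    (hG : (a : EReal) * Φ z < logAbs G z) (hφs : (s : EReal) * Φ z < φ₀ z) :
    dens0 f₀ φ₀ z * wexp (-2) Φ z ≤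
      ENNReal.ofReal (Real.exp (2 * (c - (a + s + 1 - b)) * A + 2 * C)) *
        ((‖G z‖₊ : ℝ≥0∞) ^ 2 * wexp (-2 * c) Φ z) := by
  induction hΦz : Φ z with
  | bot =>
    rcases hb.eq_or_lt with rfl | hb
    · have hGz : G z ≠ 0 := by
        intro h0
        rw [logAbs_eq_bot_iff.2 h0] at hG
        exact not_lt_bot hG
      rw [wexp_bot (c := -2 * c) (by linarith) hΦz, ENNReal.mul_top (by simpa using hGz),
        ENNReal.mul_top (by simp [Real.exp_pos])]
      exact le_top
    · rw [hΦz, EReal.coe_mul_bot_of_pos hb, EReal.bot_add, le_bot_iff] at hf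
      rw [dens0, normSq2_eq_zero hf]
      simp
  | top => exact absurd (top_le_iff.1 (hΦz ▸ hzA)) (EReal.coe_ne_top _)
  | coe x =>
    rw [hΦz] at hzA hf hG hφs
    rw [← EReal.coe_mul] at hf hG hφs
    rw [← EReal.coe_add] at hf
    have hxA : x ≤ A := EReal.coe_le_coe_iff.1 hzA
    have hy : φ₀ z = ((φ₀ z).toReal : EReal) :=
      (EReal.coe_toReal hφ.ne (ne_bot_of_gt hφs)).symm
    set y := (φ₀ z).toReal
    have hxy : s * x < y := by
      rw [hy] at hφs
      exact EReal.coe_lt_coe_iff.1 hφs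
    rw [dens0, wexp_coe _ hΦz, wexp_coe _ hΦz, wexp_coe _ hy]
    calc normSq2 f₀ z * ENNReal.ofReal (Real.exp (-2 * y)) * ENNReal.ofReal (Real.exp (-2 * x))
        ≤ ENNReal.ofReal (Real.exp (2 * (b * x + C))) * ENNReal.ofReal (Real.exp (-2 * y)) *
            ENNReal.ofReal (Real.exp (-2 * x)) := by
          gcongr
          exact normSq2_le_exp hf
      _ = ENNReal.ofReal (Real.exp (2 * (b * x + C) + -2 * y + -2 * x)) := by
          rw [Real.exp_add, Real.exp_add, ENNReal.ofReal_mul (by positivity),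
            ENNReal.ofReal_mul (by positivity)]
      _ ≤ ENNReal.ofReal (Real.exp (2 * (c - (a + s + 1 - b)) * A + 2 * C +
            (2 * (a * x) + -2 * c * x))) := by
          refine ENNReal.ofReal_le_ofReal (Real.exp_le_exp.2 ?_)
          nlinarith [mul_le_mul_of_nonneg_left hxA (sub_pos.2 hc).le]
      _ = ENNReal.ofReal (Real.exp (2 * (c - (a + s + 1 - b)) * A + 2 * C)) *
            (ENNReal.ofReal (Real.exp (2 * (a * x))) *
              ENNReal.ofReal (Real.exp (-2 * c * x))) := by
          rw [Real.exp_add _ (2 * (a * x) + -2 * c * x), Real.exp_add (2 * (a * x)),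
            ENNReal.ofReal_mul (by positivity), ENNReal.ofReal_mul (by positivity)]
      _ ≤ _ := by
          gcongr
          exact exp_le_nnnorm_sq hG

lemma IsLocalZhouWeight.le_of_intNear (hΦ : IsLocalZhouWeight f₀ φ₀ Φ) (hG : HoloNear G)
    (hG0 : ¬ (∀ᶠ z in 𝓝 (0 : Cn n), G z = 0)) {b c : ℝ} (hb : 0 ≤ b)
    (hbf : leO (logAbsT f₀) fun z => (b : EReal) * Φ z)
    (hc : IntNear fun z => (‖G z‖₊ : ℝ≥0∞) ^ 2 * wexp (-2 * c) Φ z) :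
    c ≤ nuNumber G Φ - b + 1 + zhouNumber φ₀ Φ := by
  have hν : 0 ≤ nuNumber G Φ := Real.sSup_nonneg fun b hb => hb.1
  have hσ : 0 ≤ zhouNumber φ₀ Φ := Real.sSup_nonneg fun b hb => hb.1
  refine le_of_forall_pos_lt_add fun ε hε => ?_
  by_contra! hcon
  set a := nuNumber G Φ + ε / 3 with ha
  set s := zhouNumber φ₀ Φ + ε / 3 with hs
  have ha0 : 0 < a := by positivity
  have hs0 : 0 < s := by positivity
  have hW := hΦ.measNear
  have h1 := hΦ.zhou.intNear_max hW (subMeanNear_logAbs hG) (hΦ.bddAbove_nu hG hG0) ha0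
    (show nuNumber G Φ < a by linarith)
  have h2 := hΦ.zhou.intNear_max hW hΦ.psh₀.subMeanNear hΦ.bddAbove_sigma hs0
    (show zhouNumber φ₀ Φ < s by linarith)
  obtain ⟨A, -, hA⟩ := hΦ.zhou.psh.subMeanNear.eventually_le
  obtain ⟨A', -, hA'⟩ := hΦ.psh₀.subMeanNear.eventually_le
  obtain ⟨C, hC⟩ := hbf
  have h3 := hc.const_mul (Real.exp (2 * (c - (a + s + 1 - b)) * A + 2 * C))
  have hm3 : MeasNear fun z => ENNReal.ofReal (Real.exp (2 * (c - (a + s + 1 - b)) * A + 2 * C)) *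
      ((‖G z‖₊ : ℝ≥0∞) ^ 2 * wexp (-2 * c) Φ z) :=
    (MeasNear.of_measurable measurable_const).mul
      (hG.measNear_sq.mul (hΦ.zhou.psh.subMeanNear.measNear_wexp _))
  have hm1 := hW.mul ((hΦ.zhou.pshNear_max hW (subMeanNear_logAbs hG)
    (one_div_pos.2 ha0)).subMeanNear.measNear_wexp (-2))
  have h4 := (h1.add hm1 (h3.add hm3 h2))
  refine hΦ.zhou.nonint (h4.mono ?_)
  filter_upwards [mem_inf_of_left hA, mem_inf_of_left hA', mem_inf_of_left hC] with z hzA hzA' hzC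
  by_cases hGz : logAbs G z ≤ (a : EReal) * Φ z
  · refine le_trans ?_ le_self_add
    gcongr
    exact wexp_le_wexp_max ha0 hGz
  by_cases hφz : φ₀ z ≤ (s : EReal) * Φ z
  · refine le_trans ?_ (le_add_self.trans le_add_self)
    gcongr
    exact wexp_le_wexp_max hs0 hφz
  exact (dens0_mul_wexp_le hb ha0 hs0 (by linarith) hzA (hzA'.trans_lt (EReal.coe_lt_top _)) hzC
    (not_le.1 hGz) (not_le.1 hφz)).trans (le_self_add.trans le_add_self)

lemma intNear_nnnorm_sq_mul {b c : ℝ} (hb : 0 ≤ b) (hΦ : SubMeanNear Φ)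
    (hbG : leO (logAbs G) fun z => (b : EReal) * Φ z) (hc : IntNear fun z => wexp (-2 * c) Φ z) :
    IntNear fun z => (‖G z‖₊ : ℝ≥0∞) ^ 2 * wexp (-2 * (b + c)) Φ z := by
  obtain ⟨A, -, hA⟩ := hΦ.eventually_le
  obtain ⟨C, hC⟩ := hbG
  refine (hc.const_mul (Real.exp (2 * C))).mono ?_
  filter_upwards [mem_inf_of_left hA, mem_inf_of_left hC] with z hzA hzC
  rcases hb.eq_or_lt with rfl | hb
  · rw [zero_add]
    gcongr
    exact nnnorm_sq_le_exp (by simpa using hzC)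
  induction hΦz : Φ z with
  | bot =>
    rw [hΦz, EReal.coe_mul_bot_of_pos hb, EReal.bot_add, le_bot_iff, logAbs_eq_bot_iff] at hzC
    simp [hzC]
  | top => exact absurd (top_le_iff.1 (hΦz ▸ hzA)) (EReal.coe_ne_top _)
  | coe x =>
    rw [hΦz, ← EReal.coe_mul, ← EReal.coe_add] at hzC
    rw [wexp_coe _ hΦz, wexp_coe _ hΦz]
    calc (‖G z‖₊ : ℝ≥0∞) ^ 2 * ENNReal.ofReal (Real.exp (-2 * (b + c) * x))
        ≤ ENNReal.ofReal (Real.exp (2 * (b * x + C))) *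
            ENNReal.ofReal (Real.exp (-2 * (b + c) * x)) := by
          gcongr
          exact nnnorm_sq_le_exp hzC
      _ = _ := by
          rw [← ENNReal.ofReal_mul (by positivity), ← ENNReal.ofReal_mul (by positivity),
            ← Real.exp_add, ← Real.exp_add]
          congr 2
          ring

lemma IsZhouWeightFor.intNear_wexp_of_lt_one {W : Cn n → ℝ≥0∞} (hZ : IsZhouWeightFor W Φ)
    (hW : ∀ z, W z = 1) {c : ℝ} (hc0 : 0 < c) (hc1 : c < 1) :
    IntNear fun z => wexp (-2 * c) Φ z := by
  obtain rfl : W = fun _ => 1 := funext hW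
  have hWm : MeasNear fun _ : Cn n => (1 : ℝ≥0∞) := MeasNear.of_measurable measurable_const
  have hp := hZ.psh.subMeanNear
  obtain ⟨A, hA0, hA⟩ := hp.eventually_le
  rcases hZ.intNear_or_leO hWm hp hc0 with h1 | ⟨C, hC⟩
  · refine (h1.const_mul (Real.exp (2 * ((1 - c) * A)))).mono ?_
    filter_upwards [mem_inf_of_left hA] with z hzA
    rw [one_mul]
    induction hΦz : Φ z with
    | bot =>
      rw [wexp_bot (φ := fun z => max (Φ z) (aff c 0 (Φ z))) (by norm_num)
        (by simp [hΦz, aff_bot hc0]), ENNReal.mul_top (by simp [Real.exp_pos])]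
      exact le_top
    | top => exact absurd (top_le_iff.1 (hΦz ▸ hzA)) (EReal.coe_ne_top _)
    | coe x =>
      have hxA : x ≤ A := EReal.coe_le_coe_iff.1 (hΦz ▸ hzA)
      have hmax : (fun z => max (Φ z) (aff c 0 (Φ z))) z = ((max x (c * x + 0) : ℝ) : EReal) := by
        simp only [hΦz, aff_coe]
        exact (EReal.coe_strictMono.monotone.map_max).symm
      rw [wexp_coe _ hΦz, wexp_coe _ hmax, ← ENNReal.ofReal_mul (by positivity), ← Real.exp_add]
      refine ENNReal.ofReal_le_ofReal (Real.exp_le_exp.2 ?_)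
      have h2 : max x (c * x + 0) ≤ c * x + (1 - c) * A :=
        max_le (by nlinarith) (by nlinarith)
      linarith
  · exfalso
    obtain ⟨r, hr, hrC⟩ := Metric.mem_nhds_iff.1 (inter_mem hC hA)
    obtain ⟨z, hzB, hzb, hz⟩ := hZ.exists_lt_neg intNear_one (hZ.ae_eq_zero_of_eq_bot hWm) hr
      (C / (1 - c))
    have hzC : aff c 0 (Φ z) ≤ Φ z + C := (hrC hzB).1
    have hx : Φ z = ((Φ z).toReal : EReal) := (EReal.coe_toReal (ne_top_of_lt hz) hzb).symm
    rw [hx, aff_coe, ← EReal.coe_add, EReal.coe_le_coe_iff] at hzC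
    rw [hx, EReal.coe_lt_coe_iff, lt_neg, div_lt_iff₀ (by linarith)] at hz
    linarith

lemma IsZhouWeightFor.zhouNumber_zero {W : Cn n → ℝ≥0∞} (hi : IntNear W)
    (hZ : IsZhouWeightFor W Φ) : zhouNumber (fun _ => 0) Φ = 0 := by
  refine le_antisymm (Real.sSup_nonpos fun b hb => ?_) (Real.sSup_nonneg fun b hb => hb.1)
  obtain ⟨-, C, hC⟩ := hb
  by_contra! hb
  obtain ⟨r, hr, hrC⟩ := Metric.mem_nhds_iff.1 hC
  obtain ⟨z, hzB, -, hz⟩ := hZ.exists_lt_neg (h := fun _ => 0) hi (by simp) hr (C / b)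
  have hzC : (0 : EReal) ≤ (b : EReal) * Φ z + C := hrC hzB
  refine absurd (hzC.trans_lt ?_) (lt_irrefl _)
  induction hx : Φ z with
  | bot => simp [EReal.coe_mul_bot_of_pos hb]
  | top => exact absurd (hx ▸ hz) (by simp)
  | coe x =>
    rw [hx, EReal.coe_lt_coe_iff, lt_neg, div_lt_iff₀ hb] at hz
    rw [← EReal.coe_mul, ← EReal.coe_add, ← EReal.coe_zero, EReal.coe_lt_coe_iff]
    linarith

end Local

/-- jumping numbers and Zhou valuations control each other linearly. -/
theorem statement5 {n m : ℕ} (f₀ : Fin m → Cn n → ℂ) (φ₀ Φ : Cn n → EReal)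
    (hΦ : IsLocalZhouWeight f₀ φ₀ Φ)
    (G : Cn n → ℂ) (hG : HoloNear G) (hG0 : ¬ (∀ᶠ z in 𝓝 (0 : Cn n), G z = 0)) :
    (nuNumber G Φ + jumping (fun _ => (1 : ℂ)) Φ ≤ jumping G Φ ∧
      jumping G Φ ≤ nuNumber G Φ - zhouNumber (logAbsT f₀) Φ + 1 + zhouNumber φ₀ Φ) ∧
    ((∀ z : Cn n, normSq2 f₀ z = 1) → (∀ z : Cn n, φ₀ z = 0) →
      nuNumber G Φ + 1 = jumping G Φ) := by
  have hp := hΦ.zhou.psh.subMeanNear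
  have hbdd := hΦ.bddAbove_nu hG hG0
  obtain ⟨A, -, hA⟩ := (subMeanNear_logAbs hG).eventually_le
  have hν0 : (0 : ℝ) ∈ {b : ℝ | 0 ≤ b ∧ leO (logAbs G) fun z => (b : EReal) * Φ z} :=
    ⟨le_rfl, leO_zero_mul hA⟩
  obtain ⟨A', hA'⟩ := eventually_logAbsT_le hΦ.holo
  have hf0 : (0 : ℝ) ∈ {b : ℝ | 0 ≤ b ∧ leO (logAbsT f₀) fun z => (b : EReal) * Φ z} :=
    ⟨le_rfl, leO_zero_mul hA'⟩
  have hJ1 : (0 : ℝ) ∈ {c : ℝ | 0 ≤ c ∧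
      IntNear fun z => (‖(1 : ℂ)‖₊ : ℝ≥0∞) ^ 2 * wexp (-2 * c) Φ z} := by
    refine ⟨le_rfl, ?_⟩
    simpa [wexp_zero] using intNear_one (n := n)
  have hadd : ∀ b ∈ {b : ℝ | 0 ≤ b ∧ leO (logAbs G) fun z => (b : EReal) * Φ z},
      ∀ c ∈ {c : ℝ | 0 ≤ c ∧ IntNear fun z => (‖(1 : ℂ)‖₊ : ℝ≥0∞) ^ 2 * wexp (-2 * c) Φ z},
      b + c ∈ {c : ℝ | 0 ≤ c ∧ IntNear fun z => (‖G z‖₊ : ℝ≥0∞) ^ 2 * wexp (-2 * c) Φ z} :=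
    fun b hb c hc => ⟨add_nonneg hb.1 hc.1,
      intNear_nnnorm_sq_mul hb.1 hp hb.2 (by simpa using hc.2)⟩
  have hJGbdd : BddAbove {c : ℝ | 0 ≤ c ∧
      IntNear fun z => (‖G z‖₊ : ℝ≥0∞) ^ 2 * wexp (-2 * c) Φ z} :=
    ⟨_, fun c hc => hΦ.le_of_intNear hG hG0 le_rfl hf0.2 hc.2⟩
  have hJ1bdd : BddAbove {c : ℝ | 0 ≤ c ∧
      IntNear fun z => (‖(1 : ℂ)‖₊ : ℝ≥0∞) ^ 2 * wexp (-2 * c) Φ z} := by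
    obtain ⟨R, hR⟩ := hJGbdd
    exact ⟨R, fun c hc => by simpa using hR (hadd 0 hν0 c hc)⟩
  have hlower : nuNumber G Φ + jumping (fun _ => (1 : ℂ)) Φ ≤ jumping G Φ := by
    rw [← le_sub_iff_add_le]
    refine csSup_le ⟨0, hν0⟩ fun b hb => ?_
    rw [le_sub_comm]
    refine csSup_le ⟨0, hJ1⟩ fun c hc => ?_
    rw [le_sub_iff_add_le, add_comm]
    exact le_csSup hJGbdd (hadd b hb c hc)
  have hupper : jumping G Φ ≤
      nuNumber G Φ - zhouNumber (logAbsT f₀) Φ + 1 + zhouNumber φ₀ Φ := by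
    have h1 : zhouNumber (logAbsT f₀) Φ ≤ nuNumber G Φ + 1 + zhouNumber φ₀ Φ - jumping G Φ := by
      refine csSup_le ⟨0, hf0⟩ fun b hb => ?_
      rw [le_sub_comm]
      refine csSup_le ⟨_, hadd 0 hν0 0 hJ1⟩ fun c hc => ?_
      linarith [hΦ.le_of_intNear hG hG0 hb.1 hb.2 hc.2]
    linarith
  refine ⟨⟨hlower, hupper⟩, fun hf1 hφ0 => le_antisymm ?_ ?_⟩
  · have hW : ∀ z, dens0 f₀ φ₀ z = 1 := fun z => by
      rw [dens0, hf1, wexp_coe (x := 0) _ (by simp [hφ0 z])]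
      simp
    have h1 : 1 ≤ jumping (fun _ => (1 : ℂ)) Φ := by
      refine le_of_forall_lt_imp_le_of_dense fun c hc => ?_
      rcases le_or_gt c 0 with hc0 | hc0
      · exact hc0.trans (Real.sSup_nonneg fun b hb => hb.1)
      · refine le_csSup hJ1bdd ⟨hc0.le, ?_⟩
        simpa using hΦ.zhou.intNear_wexp_of_lt_one hW hc0 hc
    linarith
  · have h1 : zhouNumber φ₀ Φ = 0 := by
      rw [show φ₀ = fun _ => 0 from funext hφ0]
      exact hΦ.zhou.zhouNumber_zero hΦ.int₀
    have h2 : 0 ≤ zhouNumber (logAbsT f₀) Φ := Real.sSup_nonneg fun b hb => hb.1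
    linarith
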